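/- arXiv:2401.14669 — 5 statements merged into one kernel-verified Lean document; each statement's English description precedes it below -/
import Mathlib

section
/- Let p be the hidden Markov model measure associated with an initial distribution f_0, transition kernels (f_t)_{t=1}^n and observation kernels (g_t)_{t=0}^n on standard Borel spaces. Then p satisfies the global Markov property: for all pairwise disjoint subsets R, S, T ⊆ {0, …, n} and pairwise disjoint subsets U, V, W ⊆ {0, …, n} such that for every a ∈ R ∪ U and b ∈ T ∪ W there exists s ∈ S lying (weakly) between a and b (a ≤ s ≤ b or b ≤ s ≤ a) with s ≠ a required whenever a ∈ R and s ≠ b required whenever b ∈ T, the coordinates ((X_r)_{r ∈ R}, (Y_u)_{u ∈ U}) are conditionally independent of the coordinates ((X_t)_{t ∈ T}, (Y_w)_{w ∈ W}) given the coordinates ((X_s)_{s ∈ S}, (Y_v)_{v ∈ V}) under p. -/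
open MeasureTheory ProbabilityTheory
open scoped ENNReal

namespace HMMStmt

variable {n : ℕ}

/-- The σ-algebra on `∀ i, X i × Y i` generated by the hidden-state coordinates in `A`
together with the observation coordinates in `B`. -/
def coordSigma {X Y : Fin (n+1) → Type*} [∀ i, MeasurableSpace (X i)]
    [∀ i, MeasurableSpace (Y i)] (A B : Set (Fin (n+1))) :
    MeasurableSpace (∀ i, X i × Y i) :=
  (⨆ i ∈ A, MeasurableSpace.comap (fun ω => (ω i).1) inferInstance) ⊔
    (⨆ j ∈ B, MeasurableSpace.comap (fun ω => (ω j).2) inferInstance)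

lemma coordSigma_le {X Y : Fin (n+1) → Type*} [∀ i, MeasurableSpace (X i)]
    [∀ i, MeasurableSpace (Y i)] (A B : Set (Fin (n+1))) :
    coordSigma (X := X) (Y := Y) A B ≤ MeasurableSpace.pi := by
  refine sup_le ?_ ?_
  · exact iSup_le fun i => iSup_le fun _ => ((measurable_pi_apply i).fst).comap_le
  · exact iSup_le fun j => iSup_le fun _ => ((measurable_pi_apply j).snd).comap_le

/-- Conditional independence (in the sense of `ProbabilityTheory.CondIndep`) under `p` of
the coordinates `((X_r)_{r ∈ A}, (Y_u)_{u ∈ A'})` from `((X_t)_{t ∈ B}, (Y_w)_{w ∈ B'})`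
given `((X_s)_{s ∈ C}, (Y_v)_{v ∈ C'})`. -/
def CondIndepCoords {X Y : Fin (n+1) → Type*} [∀ i, MeasurableSpace (X i)]
    [∀ i, MeasurableSpace (Y i)] [∀ i, StandardBorelSpace (X i)]
    [∀ i, StandardBorelSpace (Y i)]
    (p : Measure (∀ i, X i × Y i)) [IsFiniteMeasure p]
    (C C' A A' B B' : Set (Fin (n+1))) : Prop :=
  CondIndep (coordSigma C C') (coordSigma A A') (coordSigma B B') (coordSigma_le C C') p

/-- Backward value function computing the iterated integral
`∫_{S_{t+1}} g_{t+1}(T_{t+1}|x_{t+1}) ⋯ (∫_{S_n} g_n(T_n|x_n) f_n(dx_n|x_{n-1})) ⋯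
f_{t+1}(dx_{t+1}|x_t)` times `g_t(T_t | x_t)`, as a function of `x_t`. -/
noncomputable def hmmBack {X Y : Fin (n+1) → Type*} [∀ i, MeasurableSpace (X i)]
    [∀ i, MeasurableSpace (Y i)]
    (f : ∀ t : Fin n, Kernel (X t.castSucc) (X t.succ))
    (g : ∀ t : Fin (n+1), Kernel (X t) (Y t))
    (S : ∀ i, Set (X i)) (T : ∀ i, Set (Y i)) : ∀ t : Fin (n+1), X t → ℝ≥0∞ :=
  Fin.reverseInduction (fun x => g (Fin.last n) x (T (Fin.last n)))
    (fun i ih x => g i.castSucc x (T i.castSucc) * ∫⁻ x' in S i.succ, ih x' ∂ (f i x))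

/-- `p` is the hidden Markov model measure associated with the initial distribution `f₀`,
the transition kernels `f` and the observation kernels `g`: for all measurable sets,
`p (∏ t, S_t × T_t) = ∫_{S_0} ⋯ ∫_{S_n} ∏_t g_t(T_t|x_t) f_n(dx_n|x_{n-1}) ⋯ f_0(dx_0)`. -/
def IsHMM {X Y : Fin (n+1) → Type*} [∀ i, MeasurableSpace (X i)]
    [∀ i, MeasurableSpace (Y i)] (p : Measure (∀ i, X i × Y i))
    (f₀ : Measure (X 0)) (f : ∀ t : Fin n, Kernel (X t.castSucc) (X t.succ))
    (g : ∀ t : Fin (n+1), Kernel (X t) (Y t)) : Prop :=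
  ∀ (S : ∀ i, Set (X i)) (T : ∀ i, Set (Y i)),
    (∀ i, MeasurableSet (S i)) → (∀ i, MeasurableSet (T i)) →
      p (Set.univ.pi fun i => (S i) ×ˢ (T i)) = ∫⁻ x₀ in S 0, hmmBack f g S T 0 x₀ ∂ f₀

section Semigraphoid

variable {Ω : Type*} {m₀ : MeasurableSpace Ω} {μ : Measure Ω}

lemma ae_eq_condExp_indicator_of_generateFrom [IsFiniteMeasure μ] {m : MeasurableSpace Ω}
    (hm : m ≤ m₀) {C : Set (Set Ω)} (hmC : m = MeasurableSpace.generateFrom C)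
    (hC : IsPiSystem C) (hC_univ : Set.univ ∈ C) {t : Set Ω} (ht : MeasurableSet[m₀] t) {g : Ω → ℝ}
    (hg0 : 0 ≤ᵐ[μ] g) (hgi : Integrable g μ) (hgm : StronglyMeasurable[m] g)
    (hg : ∀ D ∈ C, ∫ ω in D, g ω ∂μ = μ.real (t ∩ D)) :
    g =ᵐ[μ] μ⟦t | m⟧ := by
  have hCm : ∀ D ∈ C, MeasurableSet[m₀] D := fun D hD =>
    hm _ (by rw [hmC]; exact MeasurableSpace.measurableSet_generateFrom hD)
  have key : ∀ D, MeasurableSet[m₀] D → ∫ ω in D, g ω ∂μ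
      = ((μ.withDensity fun ω => ENNReal.ofReal (g ω)) D).toReal := fun D hD => by
    rw [withDensity_apply _ hD, integral_eq_lintegral_of_nonneg_ae (ae_restrict_of_ae hg0)
      hgi.aestronglyMeasurable.restrict]
  have hfin : IsFiniteMeasure (μ.withDensity fun ω => ENNReal.ofReal (g ω)) :=
    isFiniteMeasure_withDensity_ofReal hgi.2
  have hCeq : ∀ D ∈ C, μ.restrict t D = (μ.withDensity fun ω => ENNReal.ofReal (g ω)) D := by
    intro D hD
    rw [Measure.restrict_apply (hCm D hD), ← ENNReal.toReal_eq_toReal_iff' (by finiteness)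
      (by finiteness), ← key D (hCm D hD), hg D hD, Set.inter_comm, Measure.real]
  refine ae_eq_condExp_of_forall_setIntegral_eq hm ((integrable_const 1).indicator ht)
    (fun s _ _ => hgi.integrableOn) (fun s hs _ => ?_) hgm.aestronglyMeasurable
  rw [key s (hm s hs), ← ext_on_measurableSpace_of_generate_finite m₀ C hCeq hm hmC hC
    (hCeq _ hC_univ) hs, Measure.restrict_apply (hm s hs), integral_indicator ht]
  simp [Measure.real, Measure.restrict_apply, ht, Set.inter_comm]

lemma isPiSystem_image2_inter (m₁ m₂ : MeasurableSpace Ω) :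
    IsPiSystem (Set.image2 (· ∩ ·) {s | MeasurableSet[m₁] s} {s | MeasurableSet[m₂] s}) := by
  rintro _ ⟨s, hs, t, ht, rfl⟩ _ ⟨s', hs', t', ht', rfl⟩ -
  exact ⟨s ∩ s', hs.inter hs', t ∩ t', ht.inter ht', Set.inter_inter_inter_comm _ _ _ _⟩

lemma generateFrom_image2_inter (m₁ m₂ : MeasurableSpace Ω) :
    m₁ ⊔ m₂ = MeasurableSpace.generateFrom
      (Set.image2 (· ∩ ·) {s | MeasurableSet[m₁] s} {s | MeasurableSet[m₂] s}) := by
  refine le_antisymm (sup_le ?_ ?_) (MeasurableSpace.generateFrom_le ?_)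
  · exact fun s hs => MeasurableSpace.measurableSet_generateFrom
      ⟨s, hs, Set.univ, MeasurableSet.univ, Set.inter_univ s⟩
  · exact fun s hs => MeasurableSpace.measurableSet_generateFrom
      ⟨Set.univ, MeasurableSet.univ, s, hs, Set.univ_inter s⟩
  · rintro _ ⟨s, hs, t, ht, rfl⟩
    have h1 : m₁ ≤ m₁ ⊔ m₂ := le_sup_left
    have h2 : m₂ ≤ m₁ ⊔ m₂ := le_sup_right
    exact (h1 s hs).inter (h2 t ht)

lemma condExp_indicator_one_nonneg (t : Set Ω) (m : MeasurableSpace Ω) :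
    0 ≤ᵐ[μ] μ⟦t | m⟧ :=
  condExp_nonneg (ae_of_all _ fun ω => Set.indicator_nonneg (fun _ _ => zero_le_one) ω)

/-- Pulling an indicator out of a conditional expectation. -/
lemma condExp_indicator_mul [IsFiniteMeasure μ] {m : MeasurableSpace Ω}
    {s : Set Ω} (hs : MeasurableSet[m₀] s) {g : Ω → ℝ} (hg : Integrable g μ)
    (hgm : StronglyMeasurable[m] g) :
    μ[s.indicator g | m] =ᵐ[μ] μ⟦s | m⟧ * g := by
  have h : s.indicator g = s.indicator (fun _ => (1 : ℝ)) * g := by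
    ext ω; by_cases hω : ω ∈ s <;> simp [hω]
  rw [h]
  exact condExp_mul_of_stronglyMeasurable_right hgm (h ▸ hg.indicator hs)
    ((integrable_const 1).indicator hs)

variable [StandardBorelSpace Ω] [IsFiniteMeasure μ]

/-- Conditional independence as insensitivity of conditional probabilities to further
conditioning. -/
lemma condIndep_iff_condExp_sup {s a b : MeasurableSpace Ω} (hs : s ≤ m₀) (ha : a ≤ m₀)
    (hb : b ≤ m₀) :
    CondIndep s a b hs μ ↔ ∀ t, MeasurableSet[b] t → μ⟦t | a ⊔ s⟧ =ᵐ[μ] μ⟦t | s⟧ := by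
  have has : a ⊔ s ≤ m₀ := sup_le ha hs
  rw [condIndep_iff _ _ _ hs ha hb]
  constructor
  · intro h t ht
    refine (ae_eq_condExp_indicator_of_generateFrom has (generateFrom_image2_inter a s)
      (isPiSystem_image2_inter a s) ⟨Set.univ, MeasurableSet.univ, Set.univ, MeasurableSet.univ,
      Set.univ_inter _⟩ (hb t ht) (condExp_indicator_one_nonneg t s) integrable_condExp
      (stronglyMeasurable_condExp.mono le_sup_right) ?_).symm
    rintro _ ⟨u, hu, v, hv, rfl⟩
    have hu' := ha u hu
    have hv' := hs v hv
    beta_reduce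
    rw [Set.inter_comm u v, ← setIntegral_indicator hu',
      ← setIntegral_condExp hs (integrable_condExp.indicator hu') hv]
    rw [setIntegral_congr_ae hv' (g := μ⟦u ∩ t | s⟧)]
    · rw [setIntegral_condExp hs ((integrable_const 1).indicator (hu'.inter (hb t ht))) hv,
        integral_indicator (hu'.inter (hb t ht))]
      simp [Measure.real, Measure.restrict_apply, hu'.inter (hb t ht)]
      congr 2
      ac_rfl
    · filter_upwards [h u t hu ht, condExp_indicator_mul (m := s) hu' integrable_condExp
        (stronglyMeasurable_condExp (f := t.indicator fun _ => (1 : ℝ)) (μ := μ))] with ω h1 h2 _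
      rw [h1, h2]
  · intro h u t hu ht
    have hu' := ha u hu
    have has' : a ≤ a ⊔ s := le_sup_left
    calc μ⟦u ∩ t | s⟧ =ᵐ[μ] μ[μ⟦u ∩ t | a ⊔ s⟧ | s] :=
          (condExp_condExp_of_le le_sup_right has).symm
      _ =ᵐ[μ] μ[u.indicator (μ⟦t | s⟧) | s] := by
          refine condExp_congr_ae ?_
          rw [← Set.indicator_indicator]
          refine (condExp_indicator ((integrable_const 1).indicator (hb t ht))
            (has' u hu)).trans ?_
          filter_upwards [h t ht] with ω hω
          simp only [Set.indicator, hω]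
      _ =ᵐ[μ] _ := condExp_indicator_mul hu' integrable_condExp stronglyMeasurable_condExp

variable {s a b c z q past : MeasurableSpace Ω}

lemma condIndep_sup_right_weak_union (hs : s ≤ m₀) (ha : a ≤ m₀) (hb : b ≤ m₀) (hc : c ≤ a)
    (h : CondIndep s a b hs μ) :
    CondIndep (s ⊔ c) a b (sup_le hs (hc.trans ha)) μ := by
  rw [condIndep_iff_condExp_sup hs ha hb] at h
  rw [condIndep_iff_condExp_sup _ ha hb]
  intro t ht
  have h1 : a ⊔ (s ⊔ c) = a ⊔ s := by
    rw [sup_comm s c, ← sup_assoc, sup_eq_left.2 hc]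
  have h2 := h t ht
  have h3 : μ⟦t | s ⊔ c⟧ =ᵐ[μ] μ⟦t | s⟧ := by
    refine (condExp_condExp_of_le (m₂ := a ⊔ s) (sup_le le_sup_right (hc.trans le_sup_left))
      (sup_le ha hs)).symm.trans ((condExp_congr_ae h2).trans ?_)
    rw [condExp_of_stronglyMeasurable (sup_le hs (hc.trans ha))
      (stronglyMeasurable_condExp.mono le_sup_left) integrable_condExp]
  rw [h1]
  exact h2.trans h3.symm

/-- Adding to the left family a variable `z` which depends on the past only through `q`. -/
lemma condIndep_sup_left_of_markov (hpast : past ≤ m₀) (hz : z ≤ m₀)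
    (hs : s ≤ past) (ha : a ≤ past) (hb : b ≤ past) (hq : q ≤ a ⊔ s)
    (h : CondIndep s a b (hs.trans hpast) μ)
    (hzq : ∀ t, MeasurableSet[z] t → μ⟦t | past⟧ =ᵐ[μ] μ⟦t | q⟧) :
    CondIndep s (a ⊔ z) b (hs.trans hpast) μ := by
  have hs' := hs.trans hpast
  have ha' := ha.trans hpast
  have hb' := hb.trans hpast
  have has' : a ⊔ s ≤ m₀ := sup_le ha' hs'
  have tower : ∀ r, q ≤ r → r ≤ past → ∀ t, MeasurableSet[z] t → μ⟦t | r⟧ =ᵐ[μ] μ⟦t | q⟧ := by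
    intro r hqr hr t ht
    refine (condExp_condExp_of_le hr hpast).symm.trans ((condExp_congr_ae (hzq t ht)).trans ?_)
    rw [condExp_of_stronglyMeasurable (hr.trans hpast)
      (stronglyMeasurable_condExp.mono hqr) integrable_condExp]
  have hbz : CondIndep (a ⊔ s) b z has' μ := by
    rw [condIndep_iff_condExp_sup has' hb' hz]
    exact fun t ht => (tower _ (hq.trans le_sup_right) (sup_le hb (sup_le ha hs)) t ht).trans
      (tower _ hq (sup_le ha hs) t ht).symm
  have hzb := (condIndep_iff_condExp_sup has' hz hb').1 hbz.symm
  rw [condIndep_iff_condExp_sup hs' ha' hb'] at h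
  rw [condIndep_iff_condExp_sup hs' (sup_le ha' hz) hb']
  intro t ht
  rw [sup_comm a z, sup_assoc]
  exact (hzb t ht).trans (h t ht)

/-- Adding to the conditioning family a variable `z` which depends on the past only
through `q`. -/
lemma condIndep_sup_cond_of_markov (hpast : past ≤ m₀) (hz : z ≤ m₀)
    (hs : s ≤ past) (ha : a ≤ past) (hb : b ≤ past) (hq : q ≤ a ⊔ s)
    (h : CondIndep s a b (hs.trans hpast) μ)
    (hzq : ∀ t, MeasurableSet[z] t → μ⟦t | past⟧ =ᵐ[μ] μ⟦t | q⟧) :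
    CondIndep (s ⊔ z) a b (sup_le (hs.trans hpast) hz) μ :=
  condIndep_of_condIndep_of_le_left (condIndep_sup_right_weak_union (hs.trans hpast)
    (sup_le (ha.trans hpast) hz) (hb.trans hpast) le_sup_right
    (condIndep_sup_left_of_markov hpast hz hs ha hb hq h hzq)) le_sup_left

end Semigraphoid
section Rectangles

variable {X Y : Fin (n+1) → Type*}

/-- The product sets `∏ t, S_t × T_t`. -/
def rect (S : ∀ i, Set (X i)) (T : ∀ i, Set (Y i)) : Set (∀ i, X i × Y i) :=
  Set.univ.pi fun i => S i ×ˢ T i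

lemma mem_rect {S : ∀ i, Set (X i)} {T : ∀ i, Set (Y i)} {ω : ∀ i, X i × Y i} :
    ω ∈ rect S T ↔ ∀ i, (ω i).1 ∈ S i ∧ (ω i).2 ∈ T i := by
  simp [rect, Set.mem_pi]

lemma rect_update_left (S : ∀ i, Set (X i)) (T : ∀ i, Set (Y i)) (t : Fin (n+1)) (C : Set (X t)) :
    rect (Function.update S t (S t ∩ C)) T = rect S T ∩ {ω | (ω t).1 ∈ C} := by
  ext ω
  simp only [Set.mem_inter_iff, mem_rect, Set.mem_ofPred_eq]
  refine ⟨fun h => ⟨fun i => ?_, ?_⟩, fun h i => ?_⟩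
  · rcases eq_or_ne i t with rfl | hi
    · have := h i
      simp only [Function.update_self] at this
      exact ⟨this.1.1, this.2⟩
    · simpa [hi] using h i
  · have := h t
    simp only [Function.update_self] at this
    exact this.1.2
  · rcases eq_or_ne i t with rfl | hi
    · simpa using ⟨⟨(h.1 i).1, h.2⟩, (h.1 i).2⟩
    · simpa [hi] using h.1 i

lemma rect_update_right (S : ∀ i, Set (X i)) (T : ∀ i, Set (Y i)) (t : Fin (n+1)) (C : Set (Y t)) :
    rect S (Function.update T t (T t ∩ C)) = rect S T ∩ {ω | (ω t).2 ∈ C} := by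
  ext ω
  simp only [Set.mem_inter_iff, mem_rect, Set.mem_ofPred_eq]
  refine ⟨fun h => ⟨fun i => ?_, ?_⟩, fun h i => ?_⟩
  · rcases eq_or_ne i t with rfl | hi
    · have := h i
      simp only [Function.update_self] at this
      exact ⟨this.1, this.2.1⟩
    · simpa [hi] using h i
  · have := h t
    simp only [Function.update_self] at this
    exact this.2.2
  · rcases eq_or_ne i t with rfl | hi
    · simpa using ⟨(h.1 i).1, (h.1 i).2, h.2⟩
    · simpa [hi] using h.1 i

lemma rect_univ : rect (X := X) (Y := Y) (fun _ => Set.univ) (fun _ => Set.univ) = Set.univ := by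
  ext; simp [mem_rect]

end Rectangles

section Coordinates

variable {X Y : Fin (n+1) → Type*} [∀ i, MeasurableSpace (X i)] [∀ i, MeasurableSpace (Y i)]

lemma coordSigma_mono {A A' B B' : Set (Fin (n+1))} (hA : A ⊆ A') (hB : B ⊆ B') :
    coordSigma (X := X) (Y := Y) A B ≤ coordSigma A' B' :=
  sup_le_sup (biSup_mono hA) (biSup_mono hB)

lemma coordSigma_sup (A A' B B' : Set (Fin (n+1))) :
    coordSigma (X := X) (Y := Y) A B ⊔ coordSigma A' B' = coordSigma (A ∪ A') (B ∪ B') := by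
  simp only [coordSigma, iSup_union]
  ac_rfl

lemma comap_fst_le_coordSigma {A : Set (Fin (n+1))} (B : Set (Fin (n+1))) {t : Fin (n+1)}
    (ht : t ∈ A) : MeasurableSpace.comap (fun ω : ∀ i, X i × Y i => (ω t).1) inferInstance
      ≤ coordSigma A B :=
  le_sup_of_le_left (le_biSup (fun i => MeasurableSpace.comap
    (fun ω : ∀ i, X i × Y i => (ω i).1) inferInstance) ht)

lemma comap_snd_le_coordSigma (A : Set (Fin (n+1))) {B : Set (Fin (n+1))} {t : Fin (n+1)}
    (ht : t ∈ B) : MeasurableSpace.comap (fun ω : ∀ i, X i × Y i => (ω t).2) inferInstance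
      ≤ coordSigma A B :=
  le_sup_of_le_right (le_biSup (fun i => MeasurableSpace.comap
    (fun ω : ∀ i, X i × Y i => (ω i).2) inferInstance) ht)

lemma coordSigma_singleton_left (t : Fin (n+1)) :
    coordSigma (X := X) (Y := Y) {t} ∅
      = MeasurableSpace.comap (fun ω => (ω t).1) inferInstance := by
  simp [coordSigma]

lemma coordSigma_singleton_right (t : Fin (n+1)) :
    coordSigma (X := X) (Y := Y) ∅ {t}
      = MeasurableSpace.comap (fun ω => (ω t).2) inferInstance := by
  simp [coordSigma]

/-- Measurable rectangles constraining only the hidden states in `A` and the observations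
in `B`. -/
structure IsRectOn (A B : Set (Fin (n+1))) (S : ∀ i, Set (X i)) (T : ∀ i, Set (Y i)) : Prop where
  measurableSet_left : ∀ i, MeasurableSet (S i)
  measurableSet_right : ∀ i, MeasurableSet (T i)
  left_eq_univ : ∀ i, i ∉ A → S i = Set.univ
  right_eq_univ : ∀ i, i ∉ B → T i = Set.univ

lemma IsRectOn.mono {A A' B B' : Set (Fin (n+1))} {S : ∀ i, Set (X i)} {T : ∀ i, Set (Y i)}
    (h : IsRectOn A B S T) (hA : A ⊆ A') (hB : B ⊆ B') : IsRectOn A' B' S T :=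
  ⟨h.1, h.2, fun i hi => h.3 i fun hi' => hi (hA hi'), fun i hi => h.4 i fun hi' => hi (hB hi')⟩

lemma measurableSet_update_set {Z : Fin (n+1) → Type*} [∀ i, MeasurableSpace (Z i)]
    {S : ∀ i, Set (Z i)} (hS : ∀ i, MeasurableSet (S i)) (t : Fin (n+1)) {C : Set (Z t)}
    (hC : MeasurableSet C) (i : Fin (n+1)) : MeasurableSet (Function.update S t C i) := by
  rcases eq_or_ne i t with rfl | h
  · simpa
  · simpa [h] using hS i

lemma IsRectOn.measurableSet_coordSigma {A B : Set (Fin (n+1))} {S : ∀ i, Set (X i)}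
    {T : ∀ i, Set (Y i)} (h : IsRectOn A B S T) : MeasurableSet[coordSigma A B] (rect S T) := by
  have : rect S T = (⋂ i, {ω | (ω i).1 ∈ S i}) ∩ ⋂ i, {ω | (ω i).2 ∈ T i} := by
    ext ω
    simp [mem_rect, forall_and]
  rw [this]
  refine MeasurableSet.inter (MeasurableSet.iInter fun i => ?_) (MeasurableSet.iInter fun i => ?_)
  · by_cases hi : i ∈ A
    · exact comap_fst_le_coordSigma B hi _ ⟨S i, h.1 i, rfl⟩
    · simp [h.3 i hi]
  · by_cases hi : i ∈ B
    · exact comap_snd_le_coordSigma A hi _ ⟨T i, h.2 i, rfl⟩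
    · simp [h.4 i hi]

lemma isRectOn_univ (A B : Set (Fin (n+1))) :
    IsRectOn (X := X) (Y := Y) A B (fun _ => Set.univ) (fun _ => Set.univ) :=
  ⟨fun _ => .univ, fun _ => .univ, fun _ _ => rfl, fun _ _ => rfl⟩

lemma IsRectOn.update_left {A B : Set (Fin (n+1))} {S : ∀ i, Set (X i)} {T : ∀ i, Set (Y i)}
    (h : IsRectOn A B S T) {t : Fin (n+1)} (ht : t ∈ A) {C : Set (X t)} (hC : MeasurableSet C) :
    IsRectOn A B (Function.update S t C) T :=
  ⟨measurableSet_update_set h.1 t hC, h.2, fun i hi => by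
    have : i ≠ t := fun hit => hi (hit ▸ ht)
    simpa [this] using h.3 i hi, h.4⟩

lemma IsRectOn.update_right {A B : Set (Fin (n+1))} {S : ∀ i, Set (X i)} {T : ∀ i, Set (Y i)}
    (h : IsRectOn A B S T) {t : Fin (n+1)} (ht : t ∈ B) {C : Set (Y t)} (hC : MeasurableSet C) :
    IsRectOn A B S (Function.update T t C) :=
  ⟨h.1, measurableSet_update_set h.2 t hC, h.3, fun i hi => by
    have : i ≠ t := fun hit => hi (hit ▸ ht)
    simpa [this] using h.4 i hi⟩

lemma coordSigma_eq_generateFrom (A B : Set (Fin (n+1))) :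
    coordSigma (X := X) (Y := Y) A B
      = MeasurableSpace.generateFrom {D | ∃ S T, IsRectOn A B S T ∧ rect S T = D} := by
  refine le_antisymm (sup_le (iSup₂_le fun t ht => ?_) (iSup₂_le fun t ht => ?_))
    (MeasurableSpace.generateFrom_le ?_)
  · rintro _ ⟨C, hC, rfl⟩
    refine MeasurableSpace.measurableSet_generateFrom
      ⟨_, _, (isRectOn_univ A B).update_left ht (MeasurableSet.univ.inter hC), ?_⟩
    rw [rect_update_left, rect_univ, Set.univ_inter]
    rfl
  · rintro _ ⟨C, hC, rfl⟩
    refine MeasurableSpace.measurableSet_generateFrom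
      ⟨_, _, (isRectOn_univ A B).update_right ht (MeasurableSet.univ.inter hC), ?_⟩
    rw [rect_update_right, rect_univ, Set.univ_inter]
    rfl
  · rintro _ ⟨S, T, h, rfl⟩
    exact h.measurableSet_coordSigma

lemma isPiSystem_rect (A B : Set (Fin (n+1))) :
    IsPiSystem {D | ∃ (S : ∀ i, Set (X i)) (T : ∀ i, Set (Y i)), IsRectOn A B S T ∧
      rect S T = D} := by
  rintro _ ⟨S, T, h, rfl⟩ _ ⟨S', T', h', rfl⟩ -
  refine ⟨fun i => S i ∩ S' i, fun i => T i ∩ T' i, ⟨fun i => (h.1 i).inter (h'.1 i),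
    fun i => (h.2 i).inter (h'.2 i), fun i hi => by simp [h.3 i hi, h'.3 i hi],
    fun i hi => by simp [h.4 i hi, h'.4 i hi]⟩, ?_⟩
  ext ω
  simp only [Set.mem_inter_iff, mem_rect, ← forall_and]
  exact forall_congr' fun i => by tauto

/-- If the conditional probability of `E` given the coordinates in `A`, `B` is a function of the
single hidden state `X_t`, then the other coordinates are irrelevant. -/
lemma condExp_coordSigma_eq_singleton {p : Measure (∀ i, X i × Y i)} [IsFiniteMeasure p]
    {A B : Set (Fin (n+1))} {t : Fin (n+1)} (ht : t ∈ A) {E : Set (∀ i, X i × Y i)}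
    (hE : MeasurableSet E) {φ : X t → ℝ≥0∞} (hφ : Measurable φ) (hφ1 : ∀ x, φ x ≤ 1)
    (h : ∀ S T, IsRectOn A B S T → p (rect S T ∩ E) = ∫⁻ ω in rect S T, φ (ω t).1 ∂p) :
    p⟦E | coordSigma A B⟧ =ᵐ[p] p⟦E | coordSigma {t} ∅⟧ := by
  have hφt : ∀ x, φ x < ∞ := fun x => (hφ1 x).trans_lt ENNReal.one_lt_top
  have key : ∀ A' ⊆ A, ∀ B' ⊆ B, t ∈ A' →
      (fun ω => (φ (ω t).1).toReal) =ᵐ[p] p⟦E | coordSigma A' B'⟧ := by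
    intro A' hA B' hB ht'
    have hm : Measurable[coordSigma A' B'] fun ω : ∀ i, X i × Y i => (φ (ω t).1).toReal :=
      (hφ.ennreal_toReal.comp (comap_measurable (fun ω : ∀ i, X i × Y i => (ω t).1))).mono
        (comap_fst_le_coordSigma B' ht') le_rfl
    refine ae_eq_condExp_indicator_of_generateFrom (coordSigma_le A' B')
      (coordSigma_eq_generateFrom A' B') (isPiSystem_rect A' B')
      ⟨_, _, isRectOn_univ A' B', rect_univ⟩ hE (ae_of_all _ fun ω => ENNReal.toReal_nonneg)
      ?_ hm.stronglyMeasurable ?_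
    · refine Integrable.of_bound (hm.mono (coordSigma_le _ _) le_rfl).aestronglyMeasurable 1
        (ae_of_all _ fun ω => ?_)
      rw [Real.norm_of_nonneg ENNReal.toReal_nonneg]
      exact ENNReal.toReal_le_of_le_ofReal zero_le_one (by simpa using hφ1 _)
    · rintro _ ⟨S, T, hST, rfl⟩
      rw [integral_toReal (f := fun ω : ∀ i, X i × Y i => φ (ω t).1)
        (hφ.comp (measurable_pi_apply t).fst).aemeasurable
        (ae_of_all _ fun ω => hφt _), ← h S T (hST.mono hA hB), Set.inter_comm, Measure.real]
  exact (key A subset_rfl B subset_rfl ht).symm.trans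
    (key {t} (Set.singleton_subset_iff.2 ht) ∅ (Set.empty_subset _) rfl)

end Coordinates

section Forward

variable {X Y : Fin (n+1) → Type*} [∀ i, MeasurableSpace (X i)] [∀ i, MeasurableSpace (Y i)]
  {f₀ : Measure (X 0)} {f : ∀ t : Fin n, Kernel (X t.castSucc) (X t.succ)}
  {g : ∀ t : Fin (n+1), Kernel (X t) (Y t)} {S S' : ∀ i, Set (X i)} {T T' : ∀ i, Set (Y i)}

lemma hmmBack_last : hmmBack f g S T (Fin.last n) = fun x => g (Fin.last n) x (T (Fin.last n)) := by
  simp [hmmBack]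

lemma hmmBack_castSucc (i : Fin n) : hmmBack f g S T i.castSucc = fun x =>
    g i.castSucc x (T i.castSucc) * ∫⁻ x' in S i.succ, hmmBack f g S T i.succ x' ∂(f i x) := by
  simp [hmmBack]

lemma measurable_hmmBack [∀ i, IsSFiniteKernel (f i)] (hS : ∀ i, MeasurableSet (S i))
    (hT : ∀ i, MeasurableSet (T i)) (t : Fin (n+1)) : Measurable (hmmBack f g S T t) := by
  induction t using Fin.reverseInduction with
  | last => rw [hmmBack_last]; exact Kernel.measurable_coe _ (hT _)
  | cast i ih =>
    rw [hmmBack_castSucc]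
    exact (Kernel.measurable_coe _ (hT _)).mul (ih.setLIntegral_kernel (hS _))

/-- The backward value function depends only on later hidden states and on present and later
observations. -/
lemma hmmBack_congr (t : Fin (n+1)) (hS : ∀ i, t < i → S i = S' i) (hT : ∀ i, t ≤ i → T i = T' i) :
    hmmBack f g S T t = hmmBack f g S' T' t := by
  induction t using Fin.reverseInduction with
  | last => rw [hmmBack_last, hmmBack_last, hT _ le_rfl]
  | cast i ih =>
    rw [hmmBack_castSucc, hmmBack_castSucc, hT _ le_rfl, hS _ Fin.castSucc_lt_succ,
      ih (fun j hj => hS j (Fin.castSucc_lt_succ.trans hj))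
        (fun j hj => hT j (Fin.castSucc_lt_succ.le.trans hj))]

lemma hmmBack_of_univ [∀ i, IsMarkovKernel (f i)] [∀ i, IsMarkovKernel (g i)] (t : Fin (n+1))
    (hS : ∀ i, t < i → S i = Set.univ) (hT : ∀ i, t < i → T i = Set.univ) :
    hmmBack f g S T t = fun x => g t x (T t) := by
  induction t using Fin.reverseInduction with
  | last => rw [hmmBack_last]
  | cast i ih =>
    rw [hmmBack_castSucc, ih (fun j hj => hS j (Fin.castSucc_lt_succ.trans hj))
      (fun j hj => hT j (Fin.castSucc_lt_succ.trans hj)), hS _ Fin.castSucc_lt_succ,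
      hT _ Fin.castSucc_lt_succ]
    simp

variable (f₀ f g S T) in
/-- The unnormalised law of `X_t` on the event `{X_i ∈ S_i for i ≤ t, Y_i ∈ T_i for i < t}`. -/
noncomputable def hmmForward : ∀ t : Fin (n+1), Measure (X t) :=
  Fin.induction (f₀.restrict (S 0))
    (fun i ih => ((ih.withDensity fun x => g i.castSucc x (T i.castSucc)).bind (f i)).restrict
      (S i.succ))

lemma hmmForward_zero : hmmForward f₀ f g S T 0 = f₀.restrict (S 0) := by
  simp [hmmForward]

lemma hmmForward_succ (i : Fin n) : hmmForward f₀ f g S T i.succ =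
    (((hmmForward f₀ f g S T i.castSucc).withDensity fun x =>
      g i.castSucc x (T i.castSucc)).bind (f i)).restrict (S i.succ) := by
  simp [hmmForward]

lemma hmmForward_congr (t : Fin (n+1)) (hS : ∀ i, i ≤ t → S i = S' i)
    (hT : ∀ i, i < t → T i = T' i) :
    hmmForward f₀ f g S T t = hmmForward f₀ f g S' T' t := by
  induction t using Fin.induction with
  | zero => rw [hmmForward_zero, hmmForward_zero, hS _ le_rfl]
  | succ i ih =>
    rw [hmmForward_succ, hmmForward_succ, hS _ le_rfl, hT _ Fin.castSucc_lt_succ,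
      ih (fun j hj => hS j (hj.trans Fin.castSucc_lt_succ.le))
        (fun j hj => hT j (hj.trans Fin.castSucc_lt_succ))]

lemma hmmForward_update_inter (t : Fin (n+1)) {C : Set (X t)} (hC : MeasurableSet C) :
    hmmForward f₀ f g (Function.update S t (S t ∩ C)) T t
      = (hmmForward f₀ f g S T t).restrict C := by
  induction t using Fin.cases with
  | zero =>
    rw [hmmForward_zero, hmmForward_zero, Measure.restrict_restrict hC, Function.update_self,
      Set.inter_comm]
  | succ i =>
    rw [hmmForward_succ, hmmForward_succ, Measure.restrict_restrict hC, Function.update_self,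
      Set.inter_comm, hmmForward_congr (S' := S) (T' := T) i.castSucc (fun j hj => ?_)
      (fun _ _ => rfl)]
    rw [Function.update_of_ne (hj.trans_lt Fin.castSucc_lt_succ).ne]

lemma lintegral_hmmBack_hmmForward [∀ i, IsSFiniteKernel (f i)] (hS : ∀ i, MeasurableSet (S i))
    (hT : ∀ i, MeasurableSet (T i)) (t : Fin (n+1)) :
    ∫⁻ x, hmmBack f g S T t x ∂(hmmForward f₀ f g S T t)
      = ∫⁻ x in S 0, hmmBack f g S T 0 x ∂f₀ := by
  induction t using Fin.induction with
  | zero => rw [hmmForward_zero]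
  | succ i ih =>
    have hm := measurable_hmmBack (f := f) (g := g) hS hT i.succ
    rw [← ih, hmmForward_succ, ← lintegral_indicator (hS _),
      Measure.lintegral_bind (f i).measurable.aemeasurable (hm.indicator (hS _)).aemeasurable,
      lintegral_withDensity_eq_lintegral_mul _ (Kernel.measurable_coe _ (hT _))
        (hm.indicator (hS _)).lintegral_kernel, hmmBack_castSucc]
    simp only [Pi.mul_apply, lintegral_indicator (hS _)]

variable {p : Measure (∀ i, X i × Y i)} [∀ i, IsMarkovKernel (f i)]

lemma IsHMM.measure_rect (hp : IsHMM p f₀ f g)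
    (hS : ∀ i, MeasurableSet (S i)) (hT : ∀ i, MeasurableSet (T i)) (t : Fin (n+1)) :
    p (rect S T) = ∫⁻ x, hmmBack f g S T t x ∂(hmmForward f₀ f g S T t) :=
  (hp S T hS hT).trans (lintegral_hmmBack_hmmForward hS hT t).symm

lemma IsHMM.map_restrict_rect (hp : IsHMM p f₀ f g)
    (hS : ∀ i, MeasurableSet (S i)) (hT : ∀ i, MeasurableSet (T i)) (t : Fin (n+1)) :
    (p.restrict (rect S T)).map (fun ω => (ω t).1)
      = (hmmForward f₀ f g S T t).withDensity (hmmBack f g S T t) := by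
  have hX : Measurable fun ω : ∀ i, X i × Y i => (ω t).1 := (measurable_pi_apply t).fst
  ext C hC
  rw [Measure.map_apply hX hC, Measure.restrict_apply (hX hC), withDensity_apply _ hC,
    ← hmmForward_update_inter t hC, Set.inter_comm,
    ← hmmBack_congr (S := Function.update S t (S t ∩ C))
      (T := T) t (fun i hi => Function.update_of_ne hi.ne' _ _) (fun _ _ => rfl),
    ← hp.measure_rect (measurableSet_update_set hS t ((hS t).inter hC)) hT t, rect_update_left]
  rfl

lemma IsHMM.measure_rect_inter_fst [∀ i, IsMarkovKernel (g i)] (hp : IsHMM p f₀ f g) (i : Fin n)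
    (h : IsRectOn (Set.Iio i.succ) (Set.Iio i.succ) S T) {C : Set (X i.succ)}
    (hC : MeasurableSet C) :
    p (rect S T ∩ {ω | (ω i.succ).1 ∈ C}) = ∫⁻ ω in rect S T, f i (ω i.castSucc).1 C ∂p := by
  have hlt : ∀ j, i.castSucc < j → ¬ j < i.succ := fun j hj hj' =>
    absurd (Fin.castSucc_lt_iff_succ_le.1 hj) hj'.not_ge
  have hfC : Measurable fun x => f i x C := Kernel.measurable_coe _ hC
  have hfwd : hmmForward f₀ f g (Function.update S i.succ (S i.succ ∩ C)) T i.castSucc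
      = hmmForward f₀ f g S T i.castSucc := hmmForward_congr _
    (fun j hj => Function.update_of_ne (hj.trans_lt Fin.castSucc_lt_succ).ne _ _) fun _ _ => rfl
  rw [← rect_update_left, hp.measure_rect (measurableSet_update_set h.1 _ ((h.1 _).inter hC)) h.2
    i.castSucc, hfwd, ← lintegral_map (f := fun x => f i x C) hfC (measurable_pi_apply _).fst,
    hp.map_restrict_rect h.1 h.2, lintegral_withDensity_eq_lintegral_mul _
      (measurable_hmmBack h.1 h.2 _) hfC, hmmBack_castSucc,
    hmmBack_of_univ (S := S) i.castSucc (fun j hj => h.3 j (hlt j hj)) fun j hj => h.4 j (hlt j hj),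
    hmmBack_of_univ i.succ (fun j hj => ?_) fun j hj => h.4 j (not_lt.2 hj.le),
    h.4 i.succ Set.self_notMem_Iio]
  · simp [h.3 i.succ Set.self_notMem_Iio]
  · rw [Function.update_of_ne hj.ne']
    exact h.3 j (not_lt.2 hj.le)

lemma IsHMM.measure_rect_inter_snd [∀ i, IsMarkovKernel (g i)] (hp : IsHMM p f₀ f g)
    (t : Fin (n+1)) (h : IsRectOn (Set.Iic t) (Set.Iio t) S T) {C : Set (Y t)}
    (hC : MeasurableSet C) :
    p (rect S T ∩ {ω | (ω t).2 ∈ C}) = ∫⁻ ω in rect S T, g t (ω t).1 C ∂p := by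
  have hgC : Measurable fun x => g t x C := Kernel.measurable_coe _ hC
  have hfwd : hmmForward f₀ f g S (Function.update T t (T t ∩ C)) t
      = hmmForward f₀ f g S T t := hmmForward_congr _ (fun _ _ => rfl)
    (fun j hj => Function.update_of_ne hj.ne _ _)
  rw [← rect_update_right, hp.measure_rect h.1 (measurableSet_update_set h.2 _ ((h.2 _).inter hC))
    t, hfwd, ← lintegral_map (f := fun x => g t x C) hgC (measurable_pi_apply _).fst,
    hp.map_restrict_rect h.1 h.2, lintegral_withDensity_eq_lintegral_mul _
      (measurable_hmmBack h.1 h.2 _) hgC,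
    hmmBack_of_univ (T := T) t (fun j hj => h.3 j (not_le.2 hj)) fun j hj => h.4 j (not_lt.2 hj.le),
    hmmBack_of_univ t (fun j hj => h.3 j (not_le.2 hj)) fun j hj => ?_]
  · simp [h.4 t Set.self_notMem_Iio]
  · rw [Function.update_of_ne hj.ne']
    exact h.4 j (not_lt.2 hj.le)

end Forward

section CondIndepCoords

variable {X Y : Fin (n+1) → Type*} [∀ i, MeasurableSpace (X i)] [∀ i, MeasurableSpace (Y i)]
  [∀ i, StandardBorelSpace (X i)] [∀ i, StandardBorelSpace (Y i)]
  {p : Measure (∀ i, X i × Y i)} [IsFiniteMeasure p] {A A' B B' C C' D D' : Set (Fin (n+1))}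

lemma CondIndepCoords.symm (h : CondIndepCoords p C C' A A' B B') :
    CondIndepCoords p C C' B B' A A' :=
  CondIndep.symm h

lemma condIndepCoords_empty : CondIndepCoords p ∅ ∅ ∅ ∅ ∅ ∅ := by
  have : coordSigma (X := X) (Y := Y) ∅ ∅ = ⊥ := by simp [coordSigma]
  rw [CondIndepCoords]
  simp only [this]
  exact condIndep_bot_left _

lemma CondIndepCoords.weak_union (h : CondIndepCoords p C C' A A' B B')
    (hD : D ⊆ A) (hD' : D' ⊆ A') : CondIndepCoords p (C ∪ D) (C' ∪ D') A A' B B' := by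
  have := condIndep_sup_right_weak_union (coordSigma_le _ _) (coordSigma_le _ _)
    (coordSigma_le _ _) (coordSigma_mono hD hD') h
  simpa only [CondIndepCoords, coordSigma_sup] using this

lemma CondIndepCoords.mono (h : CondIndepCoords p C C' A A' B B')
    {A₁ A₁' B₁ B₁' : Set (Fin (n+1))} (hA : A₁ ⊆ A) (hA' : A₁' ⊆ A') (hB : B₁ ⊆ B)
    (hB' : B₁' ⊆ B') : CondIndepCoords p C C' A₁ A₁' B₁ B₁' :=
  condIndep_of_condIndep_of_le_left (condIndep_of_condIndep_of_le_right h
    (coordSigma_mono hB hB')) (coordSigma_mono hA hA')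

end CondIndepCoords

section GlobalMarkov

variable {X Y : Fin (n+1) → Type*} [∀ i, MeasurableSpace (X i)] [∀ i, MeasurableSpace (Y i)]
  {f₀ : Measure (X 0)} {f : ∀ t : Fin n, Kernel (X t.castSucc) (X t.succ)}
  {g : ∀ t : Fin (n+1), Kernel (X t) (Y t)} [∀ i, IsMarkovKernel (f i)]
  [∀ i, IsMarkovKernel (g i)] {p : Measure (∀ i, X i × Y i)} [IsProbabilityMeasure p]

/-- Local Markov property of the hidden states: given its predecessor (if any), `X_k` is
independent of the past. -/
lemma IsHMM.condExp_fst (hp : IsHMM p f₀ f g) (k : Fin (n+1)) (E : Set (∀ i, X i × Y i))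
    (hE : MeasurableSet[coordSigma {k} ∅] E) :
    p⟦E | coordSigma (Set.Iio k) (Set.Iio k)⟧
      =ᵐ[p] p⟦E | coordSigma {i | (i : ℕ) + 1 = k} ∅⟧ := by
  induction k using Fin.cases with
  | zero =>
    have h1 : Set.Iio (0 : Fin (n+1)) = ∅ := by ext; simp
    have h2 : {i : Fin (n+1) | (i : ℕ) + 1 = (0 : Fin (n+1))} = ∅ := by ext; simp
    rw [h1, h2]
  | succ i =>
    have h2 : {j : Fin (n+1) | (j : ℕ) + 1 = i.succ} = {i.castSucc} := by
      ext j; simp [Fin.ext_iff]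
    rw [h2]
    rw [coordSigma_singleton_left] at hE
    obtain ⟨C, hC, rfl⟩ := hE
    exact condExp_coordSigma_eq_singleton (Set.mem_Iio.2 Fin.castSucc_lt_succ)
      ((measurable_pi_apply _).fst hC) (Kernel.measurable_coe (f i) hC) (fun _ => prob_le_one)
      fun S T h => hp.measure_rect_inter_fst i h hC

/-- Local Markov property of the observations: given `X_k`, the observation `Y_k` is
independent of the past. -/
lemma IsHMM.condExp_snd (hp : IsHMM p f₀ f g) (k : Fin (n+1)) (E : Set (∀ i, X i × Y i))
    (hE : MeasurableSet[coordSigma ∅ {k}] E) :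
    p⟦E | coordSigma (Set.Iic k) (Set.Iio k)⟧ =ᵐ[p] p⟦E | coordSigma {k} ∅⟧ := by
  rw [coordSigma_singleton_right] at hE
  obtain ⟨C, hC, rfl⟩ := hE
  exact condExp_coordSigma_eq_singleton (Set.mem_Iic.2 le_rfl)
    ((measurable_pi_apply _).snd hC) (Kernel.measurable_coe (g k) hC) (fun _ => prob_le_one)
    fun S T h => hp.measure_rect_inter_snd k h hC

variable [∀ i, StandardBorelSpace (X i)] [∀ i, StandardBorelSpace (Y i)]
  {A A' B B' C : Set (Fin (n+1))} {k : Fin (n+1)}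

lemma CondIndepCoords.insert_fst (h : CondIndepCoords p C ∅ A A' B B') (hp : IsHMM p f₀ f g)
    (hC : C ⊆ Set.Iio k) (hA : A ⊆ Set.Iio k) (hA' : A' ⊆ Set.Iio k) (hB : B ⊆ Set.Iio k)
    (hB' : B' ⊆ Set.Iio k) (hk : {i : Fin (n+1) | (i : ℕ) + 1 = k} ⊆ A ∪ C) :
    CondIndepCoords p C ∅ (insert k A) A' B B' := by
  have := condIndep_sup_left_of_markov (coordSigma_le (Set.Iio k) (Set.Iio k))
    (coordSigma_le {k} ∅) (coordSigma_mono hC (Set.empty_subset _)) (coordSigma_mono hA hA')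
    (coordSigma_mono hB hB')
    ((coordSigma_mono hk (Set.empty_subset _)).trans (coordSigma_sup A C A' ∅).ge)
    h (hp.condExp_fst k)
  simpa only [CondIndepCoords, coordSigma_sup, Set.union_singleton, Set.union_empty] using this

lemma CondIndepCoords.insert_cond (h : CondIndepCoords p C ∅ A A' B B') (hp : IsHMM p f₀ f g)
    (hC : C ⊆ Set.Iio k) (hA : A ⊆ Set.Iio k) (hA' : A' ⊆ Set.Iio k) (hB : B ⊆ Set.Iio k)
    (hB' : B' ⊆ Set.Iio k) (hk : {i : Fin (n+1) | (i : ℕ) + 1 = k} ⊆ A ∪ C) :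
    CondIndepCoords p (insert k C) ∅ A A' B B' := by
  have := condIndep_sup_cond_of_markov (coordSigma_le (Set.Iio k) (Set.Iio k))
    (coordSigma_le {k} ∅) (coordSigma_mono hC (Set.empty_subset _)) (coordSigma_mono hA hA')
    (coordSigma_mono hB hB')
    ((coordSigma_mono hk (Set.empty_subset _)).trans (coordSigma_sup A C A' ∅).ge)
    h (hp.condExp_fst k)
  simpa only [CondIndepCoords, coordSigma_sup, Set.union_singleton, Set.union_empty] using this

lemma CondIndepCoords.insert_snd (h : CondIndepCoords p C ∅ A A' B B') (hp : IsHMM p f₀ f g)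
    (hC : C ⊆ Set.Iic k) (hA : A ⊆ Set.Iic k) (hA' : A' ⊆ Set.Iio k) (hB : B ⊆ Set.Iic k)
    (hB' : B' ⊆ Set.Iio k) (hk : k ∈ A ∪ C) :
    CondIndepCoords p C ∅ A (insert k A') B B' := by
  have := condIndep_sup_left_of_markov (coordSigma_le (Set.Iic k) (Set.Iio k))
    (coordSigma_le ∅ {k}) (coordSigma_mono hC (Set.empty_subset _)) (coordSigma_mono hA hA')
    (coordSigma_mono hB hB')
    ((coordSigma_mono (Set.singleton_subset_iff.2 hk) (Set.empty_subset _)).trans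
      (coordSigma_sup A C A' ∅).ge)
    h (hp.condExp_snd k)
  simpa only [CondIndepCoords, coordSigma_sup, Set.union_singleton, Set.union_empty] using this

/-- Given `X_C`, the remaining coordinates coloured `(A, A')` are independent of those coloured
otherwise, as soon as every edge of the model avoiding `C` joins coordinates of the same
colour. -/
lemma IsHMM.condIndepCoords_compl (hp : IsHMM p f₀ f g) (hAC : Disjoint A C)
    (hX : ∀ i j : Fin (n+1), (i : ℕ) + 1 = j → i ∉ C → j ∉ C → (i ∈ A ↔ j ∈ A))
    (hY : ∀ i, i ∉ C → (i ∈ A ↔ i ∈ A')) :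
    CondIndepCoords p C ∅ A A' (A ∪ C)ᶜ A'ᶜ := by
  have stepX : ∀ k : Fin (n+1),
      CondIndepCoords p (C ∩ Set.Iio k) ∅ (A ∩ Set.Iio k) (A' ∩ Set.Iio k)
        ((A ∪ C)ᶜ ∩ Set.Iio k) (A'ᶜ ∩ Set.Iio k) →
      CondIndepCoords p (C ∩ Set.Iic k) ∅ (A ∩ Set.Iic k) (A' ∩ Set.Iio k)
        ((A ∪ C)ᶜ ∩ Set.Iic k) (A'ᶜ ∩ Set.Iio k) := by
    intro k h
    have hlt : ∀ i : Fin (n+1), (i : ℕ) + 1 = k → i < k := fun i hi => Fin.lt_def.2 (by omega)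
    rw [← Set.Iio_insert]
    have hi := fun Z : Set (Fin (n+1)) => @Set.inter_subset_right _ Z (Set.Iio k)
    by_cases hkC : k ∈ C
    · have hkA : k ∉ A := fun hkA => Set.disjoint_left.1 hAC hkA hkC
      rw [Set.inter_insert_of_mem hkC, Set.inter_insert_of_notMem hkA,
        Set.inter_insert_of_notMem (s := (A ∪ C)ᶜ) fun h => h (Or.inr hkC)]
      by_cases hpar : {i : Fin (n+1) | (i : ℕ) + 1 = k} ⊆ A ∪ C
      · exact h.insert_cond hp (hi _) (hi _) (hi _) (hi _) (hi _) fun i hik =>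
          (hpar hik).imp (⟨·, hlt i hik⟩) (⟨·, hlt i hik⟩)
      · obtain ⟨j, hj, hjAC⟩ := Set.not_subset.1 hpar
        refine (h.symm.insert_cond hp (hi _) (hi _) (hi _) (hi _) (hi _) fun i hik => ?_).symm
        obtain rfl : i = j := Fin.ext (Nat.succ_injective (hik.trans (Eq.symm hj)))
        exact Or.inl ⟨hjAC, hlt i hik⟩
    · by_cases hkA : k ∈ A
      · rw [Set.inter_insert_of_notMem hkC, Set.inter_insert_of_mem hkA,
          Set.inter_insert_of_notMem (s := (A ∪ C)ᶜ) fun h => h (Or.inl hkA)]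
        refine h.insert_fst hp (hi _) (hi _) (hi _) (hi _) (hi _) fun i hik => ?_
        by_cases hiC : i ∈ C
        · exact Or.inr ⟨hiC, hlt i hik⟩
        · exact Or.inl ⟨(hX i k hik hiC hkC).2 hkA, hlt i hik⟩
      · rw [Set.inter_insert_of_notMem hkC, Set.inter_insert_of_notMem hkA,
          Set.inter_insert_of_mem (s := (A ∪ C)ᶜ) fun h => h.elim hkA hkC]
        refine (h.symm.insert_fst hp (hi _) (hi _) (hi _) (hi _) (hi _) fun i hik => ?_).symm
        by_cases hiC : i ∈ C
        · exact Or.inr ⟨hiC, hlt i hik⟩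
        · exact Or.inl ⟨fun h => h.elim (fun hiA => hkA ((hX i k hik hiC hkC).1 hiA)) hiC,
            hlt i hik⟩
  have stepY : ∀ k : Fin (n+1),
      CondIndepCoords p (C ∩ Set.Iic k) ∅ (A ∩ Set.Iic k) (A' ∩ Set.Iio k)
        ((A ∪ C)ᶜ ∩ Set.Iic k) (A'ᶜ ∩ Set.Iio k) →
      CondIndepCoords p (C ∩ Set.Iic k) ∅ (A ∩ Set.Iic k) (A' ∩ Set.Iic k)
        ((A ∪ C)ᶜ ∩ Set.Iic k) (A'ᶜ ∩ Set.Iic k) := by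
    intro k h
    have hic := fun Z : Set (Fin (n+1)) => @Set.inter_subset_right _ Z (Set.Iic k)
    have hio := fun Z : Set (Fin (n+1)) => @Set.inter_subset_right _ Z (Set.Iio k)
    have hkk : k ∈ Set.Iic k := Set.mem_Iic.2 le_rfl
    by_cases hkA' : k ∈ A'
    · rw [← Set.Iio_insert, Set.inter_insert_of_mem hkA',
        Set.inter_insert_of_notMem (s := A'ᶜ) fun h => h hkA', Set.Iio_insert]
      refine h.insert_snd hp (hic _) (hic _) (hio _) (hic _) (hio _) ?_
      by_cases hkC : k ∈ C
      · exact Or.inr ⟨hkC, hkk⟩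
      · exact Or.inl ⟨(hY k hkC).2 hkA', hkk⟩
    · rw [← Set.Iio_insert, Set.inter_insert_of_notMem hkA',
        Set.inter_insert_of_mem (s := A'ᶜ) hkA', Set.Iio_insert]
      refine (h.symm.insert_snd hp (hic _) (hic _) (hio _) (hic _) (hio _) ?_).symm
      by_cases hkC : k ∈ C
      · exact Or.inr ⟨hkC, hkk⟩
      · exact Or.inl ⟨fun h => h.elim (fun hkA => hkA' ((hY k hkC).1 hkA)) hkC, hkk⟩
  have key : ∀ k : Fin (n+1), CondIndepCoords p (C ∩ Set.Iic k) ∅ (A ∩ Set.Iic k)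
      (A' ∩ Set.Iic k) ((A ∪ C)ᶜ ∩ Set.Iic k) (A'ᶜ ∩ Set.Iic k) := by
    intro k
    refine stepY k (stepX k ?_)
    induction k using Fin.induction with
    | zero =>
      have h0 : Set.Iio (0 : Fin (n+1)) = ∅ := by ext; simp
      simpa only [h0, Set.inter_empty] using condIndepCoords_empty
    | succ i ih =>
      have h1 : Set.Iio i.succ = Set.Iic i.castSucc := by
        ext j; simp [Fin.lt_def, Fin.le_def]
      rw [h1]
      exact stepY _ (stepX _ ih)
  have hlast : Set.Iic (Fin.last n) = Set.univ := by ext j; simp [Fin.le_last]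
  simpa only [hlast, Set.inter_univ] using key (Fin.last n)

end GlobalMarkov

/-- **Hidden Markov models satisfy the global Markov property**
(Proposition `MarkovProperties`, (iv) ⇒ (iii), instantiated in `BorelStoch`). -/
theorem isHMM_globalMarkov
    {X Y : Fin (n+1) → Type*} [∀ i, MeasurableSpace (X i)] [∀ i, MeasurableSpace (Y i)]
    [∀ i, StandardBorelSpace (X i)] [∀ i, StandardBorelSpace (Y i)]
    (p : Measure (∀ i, X i × Y i)) [IsProbabilityMeasure p]
    (f₀ : Measure (X 0)) (f : ∀ t : Fin n, Kernel (X t.castSucc) (X t.succ))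
    (g : ∀ t : Fin (n+1), Kernel (X t) (Y t))
    (hf₀ : IsProbabilityMeasure f₀) (hf : ∀ t, IsMarkovKernel (f t))
    (hg : ∀ t, IsMarkovKernel (g t)) (hp : IsHMM p f₀ f g) :
    ∀ R S T U V W : Set (Fin (n+1)),
      Disjoint R S → Disjoint R T → Disjoint S T →
      Disjoint U V → Disjoint U W → Disjoint V W →
      (∀ a, a ∈ R ∪ U → ∀ b, b ∈ T ∪ W →
        ∃ s ∈ S, ((a ≤ s ∧ s ≤ b) ∨ (b ≤ s ∧ s ≤ a)) ∧
          (a ∈ R → s ≠ a) ∧ (b ∈ T → s ≠ b)) →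
      CondIndepCoords p S V R U T W := by
  intro R S T U V W hRS _ hST _ hUW _ hsep
  let A : Set (Fin (n+1)) :=
    {i | i ∉ S ∧ ∃ a ∈ R ∪ U, ∀ s ∈ S, ¬((a ≤ s ∧ s ≤ i) ∨ (i ≤ s ∧ s ≤ a))}
  let A' : Set (Fin (n+1)) := {i | (i ∈ S ∧ i ∈ U) ∨ i ∈ A}
  have hAS : Disjoint A S := Set.disjoint_left.2 fun i hi => hi.1
  have self_mem : ∀ i ∈ R ∪ U, i ∉ S → i ∈ A := fun i hi hiS =>
    ⟨hiS, i, hi, fun s hs h => hiS (by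
      obtain rfl : s = i := h.elim (fun h => le_antisymm h.2 h.1) fun h => le_antisymm h.2 h.1
      exact hs)⟩
  have notMem : ∀ i ∈ T ∪ W, i ∉ A := by
    rintro i hi ⟨-, a, ha, h⟩
    obtain ⟨s, hs, hbt, -⟩ := hsep a ha i hi
    exact h s hs hbt
  have hind : CondIndepCoords p S ∅ A A' (A ∪ S)ᶜ A'ᶜ := by
    refine hp.condIndepCoords_compl hAS (fun i j hij hi hj => ?_) fun i hi => ?_
    · have hbetween : ∀ a s : Fin (n+1), s ∈ S →
          ((a ≤ s ∧ s ≤ i ∨ i ≤ s ∧ s ≤ a) ↔ (a ≤ s ∧ s ≤ j ∨ j ≤ s ∧ s ≤ a)) := by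
        intro a s hs
        have hsi : (s : ℕ) ≠ i := fun h => hi (Fin.ext h ▸ hs)
        have hsj : (s : ℕ) ≠ j := fun h => hj (Fin.ext h ▸ hs)
        simp only [Fin.le_def]
        omega
      have : ∀ a, (∀ s ∈ S, ¬(a ≤ s ∧ s ≤ i ∨ i ≤ s ∧ s ≤ a)) ↔
          ∀ s ∈ S, ¬(a ≤ s ∧ s ≤ j ∨ j ≤ s ∧ s ≤ a) := fun a =>
        forall₂_congr fun s hs => not_congr (hbetween a s hs)
      exact and_congr (iff_of_true hi hj) (exists_congr fun a => and_congr_right fun _ => this a)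
    · exact ⟨Or.inr, fun h => h.resolve_left fun h => hi h.1⟩
  have hV := ((hind.weak_union (Set.empty_subset _) (Set.inter_subset_right
    (s := V))).symm.weak_union (Set.empty_subset _) (Set.inter_subset_right (s := V))).symm
  rw [Set.union_empty, Set.union_empty, Set.empty_union, Set.inter_union_compl] at hV
  refine hV.mono (fun i hi => self_mem i (Or.inl hi) (Set.disjoint_left.1 hRS hi))
    (fun i hi => ?_) (fun i hi => ?_) fun i hi => ?_
  · by_cases hiS : i ∈ S
    · exact Or.inl ⟨hiS, hi⟩
    · exact Or.inr (self_mem i (Or.inr hi) hiS)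
  · exact fun h => h.elim (notMem i (Or.inl hi)) (Set.disjoint_right.1 hST hi)
  · exact fun h => h.elim (fun h => Set.disjoint_left.1 hUW h.2 hi) (notMem i (Or.inr hi))

end HMMStmt
end

section
/- Let X_0, …, X_n be nonempty finite types and p a probability mass function on ∏_{t=0}^n X_t. Then the following are equivalent: (i) for every 2 ≤ t ≤ n and every x_0 ∈ X_0, …, x_t ∈ X_t with P(X_0 = x_0, …, X_{t-1} = x_{t-1}) > 0, one has P(X_t = x_t | X_0 = x_0, …, X_{t-1} = x_{t-1}) = P(X_t = x_t | X_{t-1} = x_{t-1}); (ii) there exist an initial distribution f_0 : X_0 → [0,1] with Σ_x f_0(x) = 1 and stochastic matrices f_t : X_{t-1} × X_t → [0,1] (with Σ_{x_t} f_t(x_t | x_{t-1}) = 1 for each x_{t-1}) such that p(x_0, …, x_n) = f_0(x_0) · ∏_{t=1}^n f_t(x_t | x_{t-1}) for all (x_0, …, x_n). -/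
namespace FinStochMarkovChain

variable {n : ℕ}

/-- Probability of the event `E` under the probability mass function `p` on a finite type. -/
noncomputable def prob {Ω : Type*} [Fintype Ω] (p : Ω → ℝ) (E : Set Ω) : ℝ :=
  ∑ ω, E.indicator p ω

theorem prob_nonneg {Ω : Type*} [Fintype Ω] {p : Ω → ℝ} (hp : ∀ ω, 0 ≤ p ω) (E : Set Ω) :
    0 ≤ prob p E :=
  Finset.sum_nonneg fun ω _ => Set.indicator_nonneg (fun ω _ => hp ω) ω

theorem prob_mono {Ω : Type*} [Fintype Ω] {p : Ω → ℝ} (hp : ∀ ω, 0 ≤ p ω) {E F : Set Ω}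
    (h : E ⊆ F) : prob p E ≤ prob p F :=
  Finset.sum_le_sum fun ω _ => Set.indicator_le_indicator_of_subset h hp ω

theorem prob_singleton {Ω : Type*} [Fintype Ω] (p : Ω → ℝ) (a : Ω) : prob p {a} = p a := by
  classical
  simp [prob, Set.indicator_apply]

theorem prob_eq_sum_mul_indicator {Ω : Type*} [Fintype Ω] (p : Ω → ℝ) (E : Set Ω) :
    prob p E = ∑ ω, p ω * E.indicator 1 ω := by
  classical
  simp [prob, Set.indicator_apply]

/-- The law of total probability over the fibres of a map `g`. -/
theorem sum_prob_fiber {Ω Y : Type*} [Fintype Ω] [Fintype Y] (p : Ω → ℝ) (g : Ω → Y)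
    (E : Set Ω) : ∑ y, prob p {ω | g ω = y ∧ ω ∈ E} = prob p E := by
  classical
  unfold prob
  rw [Finset.sum_comm]
  refine Finset.sum_congr rfl fun ω _ => ?_
  simp only [Set.indicator_apply, Set.mem_ofPred_eq, ite_and]
  simp

/-- Resampling one coordinate in a sum over a finite product. -/
theorem sum_sum_update {ι : Type*} [Fintype ι] [DecidableEq ι] {X : ι → Type*}
    [∀ i, Fintype (X i)] (F : (∀ i, X i) → ℝ) (j : ι) :
    ∑ ω, ∑ x, F (Function.update ω j x) = Fintype.card (X j) * ∑ ω, F ω := by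
  have hinv : Function.Involutive
      fun q : (∀ i, X i) × X j => (Function.update q.1 j q.2, q.1 j) := by
    rintro ⟨ω, x⟩
    simp
  have h := Equiv.sum_comp hinv.toPerm fun q : (∀ i, X i) × X j => F q.1
  simp only [Function.Involutive.coe_toPerm, Fintype.sum_prod_type] at h
  rw [h]
  simp [Finset.mul_sum]

section PathWeight

variable {X : Fin (n + 1) → Type*}

/-- The weight of the first `k` transitions of the path `ω`, including the initial one. -/
noncomputable def pathWeight (f₀ : X 0 → ℝ) (f : ∀ t : Fin n, X t.castSucc → X t.succ → ℝ)
    (k : ℕ) (ω : ∀ i, X i) : ℝ :=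
  f₀ (ω 0) * ∏ t : Fin n with t.val < k, f t (ω t.castSucc) (ω t.succ)

variable (f₀ : X 0 → ℝ) (f : ∀ t : Fin n, X t.castSucc → X t.succ → ℝ)

theorem pathWeight_zero (ω : ∀ i, X i) : pathWeight f₀ f 0 ω = f₀ (ω 0) := by
  simp [pathWeight]

theorem pathWeight_last (ω : ∀ i, X i) :
    pathWeight f₀ f n ω = f₀ (ω 0) * ∏ t : Fin n, f t (ω t.castSucc) (ω t.succ) := by
  simp [pathWeight]

theorem pathWeight_succ (t : Fin n) (ω : ∀ i, X i) :
    pathWeight f₀ f (t + 1) ω =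
      pathWeight f₀ f t ω * f t (ω t.castSucc) (ω t.succ) := by
  have : Finset.univ.filter (fun s : Fin n => (s : ℕ) < t + 1) =
      insert t (Finset.univ.filter fun s : Fin n => (s : ℕ) < t) := by
    ext s
    simp [Fin.ext_iff]
    omega
  rw [pathWeight, this, Finset.prod_insert (by simp), pathWeight]
  ring

theorem dependsOn_pathWeight (k : ℕ) :
    DependsOn (pathWeight f₀ f k) {i : Fin (n + 1) | (i : ℕ) ≤ k} := by
  intro ω ω' h
  unfold pathWeight
  rw [h 0 (by simp)]
  congr 1
  refine Finset.prod_congr rfl fun t ht => ?_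
  have ht' : (t : ℕ) < k := by simpa using ht
  rw [h t.castSucc (by simpa using ht'.le), h t.succ (by simpa using ht')]

variable [∀ i, Fintype (X i)]

theorem card_mul_sum_pathWeight_succ (t : Fin n) {G : (∀ i, X i) → ℝ}
    (hG : DependsOn G {i : Fin (n + 1) | (i : ℕ) ≤ t}) (h : X t.succ → ℝ) :
    Fintype.card (X t.succ) * ∑ ω, pathWeight f₀ f (t + 1) ω * (G ω * h (ω t.succ)) =
      ∑ ω, pathWeight f₀ f t ω * (G ω * ∑ x, f t (ω t.castSucc) x * h x) := by
  rw [← sum_sum_update]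
  refine Finset.sum_congr rfl fun ω _ => ?_
  have hne (x : X t.succ) (i : Fin (n + 1)) (hi : (i : ℕ) ≤ t) :
      Function.update ω t.succ x i = ω i :=
    Function.update_of_ne (by rintro rfl; simp at hi) _ _
  simp only [Finset.mul_sum]
  refine Finset.sum_congr rfl fun x _ => ?_
  rw [pathWeight_succ, dependsOn_pathWeight f₀ f t (hne x), hG (hne x),
    hne x t.castSucc (by simp), Function.update_self]
  ring

variable {f} [∀ i, Nonempty (X i)]

theorem exists_sum_pathWeight_eq (hf : ∀ t x, ∑ x', f t x x' = 1) {k : ℕ} (hk : k ≤ n) :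
    ∃ c : ℝ, ∀ G : (∀ i, X i) → ℝ, DependsOn G {i : Fin (n + 1) | (i : ℕ) ≤ k} →
      ∑ ω, pathWeight f₀ f n ω * G ω = c * ∑ ω, pathWeight f₀ f k ω * G ω := by
  induction hk using Nat.decreasingInduction with
  | self => exact ⟨1, fun G _ => by simp⟩
  | of_succ k hk ih =>
    obtain ⟨c, hc⟩ := ih
    refine ⟨c / Fintype.card (X (Fin.succ ⟨k, hk⟩)), fun G hG => ?_⟩
    have h := card_mul_sum_pathWeight_succ f₀ f ⟨k, hk⟩ hG 1
    simp only [Pi.one_apply, mul_one, hf] at h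
    rw [hc G (hG.mono fun i hi => Nat.le_succ_of_le hi), ← h]
    have : (Fintype.card (X (Fin.succ ⟨k, hk⟩)) : ℝ) ≠ 0 := by
      exact_mod_cast Fintype.card_ne_zero
    field_simp

/-- The Markov property for sums against path weights: the next coordinate may be replaced by
its transition probability. -/
theorem sum_pathWeight_mul_next (hf : ∀ t x, ∑ x', f t x x' = 1) (t : Fin n)
    {G : (∀ i, X i) → ℝ} (hG : DependsOn G {i : Fin (n + 1) | (i : ℕ) ≤ t})
    (h : X t.succ → ℝ) :
    ∑ ω, pathWeight f₀ f n ω * (G ω * h (ω t.succ)) =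
      ∑ ω, pathWeight f₀ f n ω * (G ω * ∑ x, f t (ω t.castSucc) x * h x) := by
  have hG' : DependsOn (fun ω => G ω * ∑ x, f t (ω t.castSucc) x * h x)
      {i : Fin (n + 1) | (i : ℕ) ≤ t} := fun ω ω' hω => by
    simp only [hG hω, hω t.castSucc (by simp)]
  obtain ⟨c, hc⟩ := exists_sum_pathWeight_eq f₀ hf (k := t + 1) t.isLt
  rw [hc, hc _ (hG'.mono fun i hi => Nat.le_succ_of_le hi)]
  · congr 1
    have hcard : (Fintype.card (X t.succ) : ℝ) ≠ 0 := by
      exact_mod_cast Fintype.card_ne_zero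
    apply mul_left_cancel₀ hcard
    rw [card_mul_sum_pathWeight_succ f₀ f t hG h]
    have h1 := card_mul_sum_pathWeight_succ f₀ f t hG' 1
    simp only [Pi.one_apply, mul_one, hf] at h1
    exact h1.symm
  · intro ω ω' hω
    simp only [hG fun i hi => hω i (Nat.le_succ_of_le hi), hω t.succ (by simp)]

theorem prob_next_eq_mul (hf : ∀ t x, ∑ x', f t x x' = 1) {p : (∀ i, X i) → ℝ}
    (hp : ∀ ω, p ω = pathWeight f₀ f n ω) (t : Fin n) {E : Set (∀ i, X i)}
    (hE : DependsOn (· ∈ E) {i : Fin (n + 1) | (i : ℕ) ≤ t}) {y : X t.castSucc}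
    (hy : ∀ ω ∈ E, ω t.castSucc = y) (x : X t.succ) :
    prob p {ω | ω t.succ = x ∧ ω ∈ E} = f t y x * prob p E := by
  classical
  have h := sum_pathWeight_mul_next f₀ hf t (G := E.indicator 1)
    (fun ω ω' hω => by simp only [Set.indicator_apply, hE hω, Pi.one_apply])
    (fun x' => if x' = x then 1 else 0)
  simp only [prob_eq_sum_mul_indicator, hp, Finset.mul_sum]
  convert h using 2 with ω _ ω _
  · by_cases hω : ω ∈ E <;> simp [Set.indicator_apply, hω]
  · by_cases hω : ω ∈ E
    · simp [hω, hy ω hω, mul_comm]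
    · simp [hω]

end PathWeight

/-- The transition probability of `p` from time `t` to time `t + 1`, taken to be uniform when the
conditioning event has probability zero. -/
noncomputable def transition {X : Fin (n + 1) → Type*} [∀ i, Fintype (X i)]
    (p : (∀ i, X i) → ℝ) (t : Fin n) (x : X t.castSucc) (x' : X t.succ) : ℝ :=
  if prob p {ω | ω t.castSucc = x} = 0 then (Fintype.card (X t.succ) : ℝ)⁻¹
  else prob p {ω | ω t.succ = x' ∧ ω t.castSucc = x} / prob p {ω | ω t.castSucc = x}

theorem transition_nonneg {X : Fin (n + 1) → Type*} [∀ i, Fintype (X i)]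
    {p : (∀ i, X i) → ℝ} (hp : ∀ ω, 0 ≤ p ω) (t : Fin n) (x : X t.castSucc) (x' : X t.succ) :
    0 ≤ transition p t x x' := by
  unfold transition
  split_ifs
  · positivity
  · exact div_nonneg (prob_nonneg hp _) (prob_nonneg hp _)

theorem sum_transition {X : Fin (n + 1) → Type*} [∀ i, Fintype (X i)] [∀ i, Nonempty (X i)]
    (p : (∀ i, X i) → ℝ) (t : Fin n) (x : X t.castSucc) : ∑ x', transition p t x x' = 1 := by
  unfold transition
  split_ifs with h
  · simp
  · rw [← Finset.sum_div]
    have := sum_prob_fiber p (fun ω => ω t.succ) {ω | ω t.castSucc = x}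
    simp only [Set.mem_ofPred_eq] at this
    rw [this, div_self h]

/-- **Characterization of discrete Markov chains** (Proposition
`MarkovChainMarkovProps`, (a) ⇔ (c), instantiated in `FinStoch`): the elementary Markov
property for a probability mass function on a finite product is equivalent to a
factorization into an initial distribution and stochastic transition matrices. -/
theorem markovProperty_iff_factorization
    {X : Fin (n+1) → Type*} [∀ i, Fintype (X i)] [∀ i, Nonempty (X i)]
    (p : (∀ i, X i) → ℝ) (hp0 : ∀ ω, 0 ≤ p ω) (hp1 : ∑ ω, p ω = 1) :
    (∀ (t : ℕ) (ht2 : 2 ≤ t) (htn : t ≤ n) (xs : ∀ i, X i),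
      0 < prob p {ω | ∀ i : Fin (n+1), (i : ℕ) < t → ω i = xs i} →
      prob p {ω | ∀ i : Fin (n+1), (i : ℕ) ≤ t → ω i = xs i} /
          prob p {ω | ∀ i : Fin (n+1), (i : ℕ) < t → ω i = xs i}
        = prob p {ω | ω ⟨t, by omega⟩ = xs ⟨t, by omega⟩ ∧
              ω ⟨t - 1, by omega⟩ = xs ⟨t - 1, by omega⟩} /
            prob p {ω | ω ⟨t - 1, by omega⟩ = xs ⟨t - 1, by omega⟩})
    ↔ (∃ f₀ : X 0 → ℝ, (∀ x, 0 ≤ f₀ x) ∧ (∑ x, f₀ x = 1) ∧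
        ∃ f : ∀ t : Fin n, X t.castSucc → X t.succ → ℝ,
          (∀ t x x', 0 ≤ f t x x') ∧ (∀ t x, ∑ x', f t x x' = 1) ∧
          ∀ ω, p ω = f₀ (ω 0) * ∏ t : Fin n, f t (ω t.castSucc) (ω t.succ)) := by
  constructor
  · intro hM
    refine ⟨fun x => prob p {ω | ω 0 = x}, fun x => prob_nonneg hp0 _, ?_, transition p,
      transition_nonneg hp0, sum_transition p, fun ω => ?_⟩
    · have h := sum_prob_fiber p (fun ω => ω 0) Set.univ
      simpa [prob, hp1] using h
    · rw [← pathWeight_last (fun x => prob p {ω | ω 0 = x})]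
      suffices h : ∀ k ≤ n, prob p {ω' | ∀ i : Fin (n+1), (i : ℕ) ≤ k → ω' i = ω i} =
          pathWeight (fun x => prob p {ω | ω 0 = x}) (transition p) k ω by
        rw [← h n le_rfl, ← prob_singleton p ω]
        congr 1
        ext ω'
        simp only [Set.mem_singleton_iff, Set.mem_ofPred_eq, funext_iff]
        exact ⟨fun h i _ => h i, fun h i => h i (Nat.lt_succ_iff.mp i.isLt)⟩
      intro k hk
      induction k with
      | zero =>
        rw [pathWeight_zero]
        congr 1
        ext ω'
        exact ⟨fun h => h 0 le_rfl, fun h i hi => by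
          obtain rfl : i = 0 := Fin.ext (by simpa using hi)
          exact h⟩
      | succ k ih =>
        specialize ih (by omega)
        rw [pathWeight_succ _ _ ⟨k, hk⟩, ← ih]
        rcases (prob_nonneg hp0
          {ω' | ∀ i : Fin (n+1), (i : ℕ) ≤ k → ω' i = ω i}).eq_or_lt with h0 | hpos
        · rw [← h0, zero_mul]
          refine le_antisymm (h0 ▸ prob_mono hp0 ?_) (prob_nonneg hp0 _)
          exact fun ω' h i hi => h i (Nat.le_succ_of_le hi)
        have hpos' : 0 < prob p {ω' | ω' (Fin.castSucc ⟨k, hk⟩) = ω (Fin.castSucc ⟨k, hk⟩)} :=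
          hpos.trans_le (prob_mono hp0 fun ω' h => h _ le_rfl)
        rw [transition, if_neg hpos'.ne', mul_comm, ← div_eq_iff hpos.ne']
        rcases k.eq_zero_or_pos with rfl | hk0
        · congr 2
          · ext ω'
            refine ⟨fun h => ⟨h _ le_rfl, h _ (Nat.zero_le _)⟩, fun h i hi => ?_⟩
            rcases (Nat.le_one_iff_eq_zero_or_eq_one.mp hi) with hi | hi
            · obtain rfl : i = Fin.castSucc ⟨0, hk⟩ := Fin.ext hi
              exact h.2
            · obtain rfl : i = Fin.succ ⟨0, hk⟩ := Fin.ext hi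
              exact h.1
          · ext ω'
            refine ⟨fun h => h _ le_rfl, fun h i hi => ?_⟩
            obtain rfl : i = Fin.castSucc ⟨0, hk⟩ := Fin.ext (Nat.le_zero.mp hi)
            exact h
        · have h := hM (k + 1) (by omega) hk ω
          simp only [Nat.lt_succ_iff] at h
          exact h hpos
  · rintro ⟨f₀, -, -, f, -, hf, hp⟩ t ht2 htn xs hpos
    obtain ⟨k, rfl⟩ : ∃ k, t = k + 1 := ⟨t - 1, by omega⟩
    have hp' (ω : ∀ i, X i) : p ω = pathWeight f₀ f n ω := by rw [hp, pathWeight_last]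
    simp only [Nat.lt_succ_iff] at hpos ⊢
    have hpos' : 0 < prob p {ω | ω (Fin.castSucc ⟨k, htn⟩) = xs (Fin.castSucc ⟨k, htn⟩)} :=
      hpos.trans_le (prob_mono hp0 fun ω h => h _ le_rfl)
    have h1 := prob_next_eq_mul f₀ hf hp' ⟨k, htn⟩
      (E := {ω | ∀ i : Fin (n+1), (i : ℕ) ≤ k → ω i = xs i})
      (fun ω ω' h => by
        simp only [Set.mem_ofPred_eq, eq_iff_iff]
        exact forall₂_congr fun i hi => by rw [h i hi])
      (fun ω h => h _ le_rfl) (xs (Fin.succ ⟨k, htn⟩))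
    have h2 := prob_next_eq_mul f₀ hf hp' ⟨k, htn⟩
      (E := {ω | ω (Fin.castSucc ⟨k, htn⟩) = xs (Fin.castSucc ⟨k, htn⟩)})
      (fun ω ω' h => by
        simp only [Set.mem_ofPred_eq, h (Fin.castSucc ⟨k, htn⟩) (by simp)])
      (fun ω h => h) (xs (Fin.succ ⟨k, htn⟩))
    have hset : {ω : ∀ i, X i | ∀ i : Fin (n+1), (i : ℕ) ≤ k + 1 → ω i = xs i} =
        {ω | ω (Fin.succ ⟨k, htn⟩) = xs (Fin.succ ⟨k, htn⟩) ∧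
          ω ∈ {ω | ∀ i : Fin (n+1), (i : ℕ) ≤ k → ω i = xs i}} := by
      ext ω
      refine ⟨fun h => ⟨h _ le_rfl, fun i hi => h i (Nat.le_succ_of_le hi)⟩, fun h i hi => ?_⟩
      rcases Nat.le_succ_iff.mp hi with hi | hi
      · exact h.2 i hi
      · obtain rfl : i = Fin.succ ⟨k, htn⟩ := Fin.ext hi
        exact h.1
    rw [hset, h1, mul_div_cancel_right₀ _ hpos.ne']
    exact ((div_eq_iff hpos'.ne').mpr h2).symm

end FinStochMarkovChain
end

section
/- Fix observations y_0 ∈ Y_0, …, y_t ∈ Y_t with 0 ≤ t ≤ n and suppose p^Y_{[t]}(y_0, …, y_t) > 0. Then every denominator Σ_{x'} g_i(y_i | x') · q_i(x') appearing in the recursive definition of the instantiated Bayes filter is positive for 0 ≤ i ≤ t, and for every x ∈ X_t, B_t(x) = P_p(X_t = x ∧ Y_0 = y_0 ∧ ⋯ ∧ Y_t = y_t) / p^Y_{[t]}(y_0, …, y_t); that is, the instantiated Bayes filter computes the conditional distribution of the hidden state X_t given the observations Y_0 = y_0, …, Y_t = y_t. -/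
open scoped ENNReal Classical

namespace DiscreteHMM

variable {n : ℕ}

/-- The joint distribution of a discrete hidden Markov model with initial distribution
`f₀`, transition kernels `f` and observation kernels `g`. -/
noncomputable def hmmJoint {X Y : Fin (n+1) → Type*}
    (f₀ : PMF (X 0)) (f : ∀ t : Fin n, X t.castSucc → PMF (X t.succ))
    (g : ∀ t : Fin (n+1), X t → PMF (Y t)) (ω : ∀ t, X t × Y t) : ℝ≥0∞ :=
  f₀ (ω 0).1 * g 0 (ω 0).1 (ω 0).2 *
    ∏ t : Fin n, (f t (ω t.castSucc).1 (ω t.succ).1 * g t.succ (ω t.succ).1 (ω t.succ).2)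

/-- Probability of the event `E` under the probability mass function `p` on a finite
type. -/
noncomputable def prob {Ω : Type*} [Fintype Ω] (p : Ω → ℝ≥0∞) (E : Set Ω) : ℝ≥0∞ :=
  ∑ ω, E.indicator p ω

variable {X Y : Fin (n+1) → Type*} [∀ i, Fintype (X i)] [∀ i, Fintype (Y i)]
  [∀ i, Nonempty (X i)] [∀ i, Nonempty (Y i)]

/-- The instantiated Bayes filter `B_t` for the observation sequence `y`, computed by the
recursion `B_t(x) = g_t(y_t|x) · q_t(x) / (Σ_{x'} g_t(y_t|x') · q_t(x'))` where
`q_0 = f₀` and `q_t(x) = Σ_{x'} f_t(x|x') · B_{t-1}(x')`. -/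
noncomputable def bayesFilter (f₀ : PMF (X 0))
    (f : ∀ t : Fin n, X t.castSucc → PMF (X t.succ))
    (g : ∀ t : Fin (n+1), X t → PMF (Y t)) (y : ∀ t, Y t) :
    ∀ t : Fin (n+1), X t → ℝ≥0∞ :=
  Fin.induction
    (fun x => g 0 x (y 0) * f₀ x / ∑ x', g 0 x' (y 0) * f₀ x')
    (fun i ih x =>
      g i.succ x (y i.succ) * (∑ x', f i x' x * ih x') /
        ∑ x'', g i.succ x'' (y i.succ) * ∑ x', f i x' x'' * ih x')

/-- The predicted ("prediction step") distribution `q_t` of the instantiated Bayes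
filter: `q_0 = f₀` and `q_t(x) = Σ_{x'} f_t(x|x') · B_{t-1}(x')`. -/
noncomputable def bayesPredict (f₀ : PMF (X 0))
    (f : ∀ t : Fin n, X t.castSucc → PMF (X t.succ))
    (g : ∀ t : Fin (n+1), X t → PMF (Y t)) (y : ∀ t, Y t) :
    ∀ t : Fin (n+1), X t → ℝ≥0∞ :=
  Fin.cases (fun x => f₀ x)
    (fun i x => ∑ x', f i x' x * bayesFilter f₀ f g y i.castSucc x')

/-- The forward variable: the probability that the hidden state at time `t` is `x` and the
observations up to time `t` are `y`. -/
noncomputable def forward {n : ℕ} {X Y : Fin (n+1) → Type*} [∀ i, Fintype (X i)]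
    [∀ i, Fintype (Y i)] (f₀ : PMF (X 0))
    (f : ∀ t : Fin n, X t.castSucc → PMF (X t.succ))
    (g : ∀ t : Fin (n+1), X t → PMF (Y t)) (y : ∀ t, Y t) (t : Fin (n+1)) (x : X t) : ℝ≥0∞ :=
  prob (hmmJoint f₀ f g)
    {ω | (ω t).1 = x ∧ ∀ i : Fin (n+1), (i : ℕ) ≤ (t : ℕ) → (ω i).2 = y i}

/-- The probability of the observations `y` up to time `t`. -/
noncomputable def evidence {n : ℕ} {X Y : Fin (n+1) → Type*} [∀ i, Fintype (X i)]
    [∀ i, Fintype (Y i)] (f₀ : PMF (X 0))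
    (f : ∀ t : Fin n, X t.castSucc → PMF (X t.succ))
    (g : ∀ t : Fin (n+1), X t → PMF (Y t)) (y : ∀ t, Y t) (t : Fin (n+1)) : ℝ≥0∞ :=
  prob (hmmJoint f₀ f g) {ω | ∀ i : Fin (n+1), (i : ℕ) ≤ (t : ℕ) → (ω i).2 = y i}

lemma prob_setOf {Ω : Type*} [Fintype Ω] (p : Ω → ℝ≥0∞) (P : Ω → Prop) :
    prob p {ω | P ω} = ∑ ω, if P ω then p ω else 0 := by
  simp [prob, Set.indicator_apply]

lemma prob_mono {Ω : Type*} [Fintype Ω] (p : Ω → ℝ≥0∞) {E F : Set Ω} (h : E ⊆ F) :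
    prob p E ≤ prob p F :=
  Finset.sum_le_sum fun ω _ => Set.indicator_le_indicator_of_subset h (fun _ => zero_le) ω

lemma sum_pmf {α : Type*} [Fintype α] (p : PMF α) : ∑ a, p a = 1 := by
  rw [← tsum_fintype (L := .unconditional _), p.tsum_coe]

lemma sum_pi_snoc {n : ℕ} {Z : Fin (n+1) → Type*} [∀ i, Fintype (Z i)]
    (F : (∀ t, Z t) → ℝ≥0∞) :
    ∑ ω, F ω = ∑ ω' : ∀ t : Fin n, Z t.castSucc, ∑ z : Z (Fin.last n), F (Fin.snoc ω' z) := by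
  rw [← (Fin.snocEquiv Z).sum_comp, Fintype.sum_prod_type, Finset.sum_comm]
  rfl

lemma hmmJoint_snoc {n : ℕ} {X Y : Fin (n+2) → Type*}
    (f₀ : PMF (X 0)) (f : ∀ t : Fin (n+1), X t.castSucc → PMF (X t.succ))
    (g : ∀ t : Fin (n+2), X t → PMF (Y t))
    (ω : ∀ t : Fin (n+1), X t.castSucc × Y t.castSucc)
    (z : X (Fin.last (n+1)) × Y (Fin.last (n+1))) :
    hmmJoint f₀ f g (Fin.snoc (α := fun t => X t × Y t) ω z) =
      hmmJoint (X := fun t => X t.castSucc) (Y := fun t => Y t.castSucc)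
        f₀ (fun t => f t.castSucc) (fun t => g t.castSucc) ω *
      (f (Fin.last n) (ω (Fin.last n)).1 z.1 * g (Fin.last (n+1)) z.1 z.2) := by
  have h (t : Fin (n+1)) : Fin.snoc (α := fun t => X t × Y t) ω z t.castSucc = ω t :=
    Fin.snoc_castSucc ..
  have h0 : Fin.snoc (α := fun t => X t × Y t) ω z 0 = ω 0 := h 0
  have hs (t : Fin n) : Fin.snoc (α := fun t => X t × Y t) ω z t.castSucc.succ = ω t.succ :=
    h t.succ
  have hl : Fin.snoc (α := fun t => X t × Y t) ω z (Fin.last n).succ = z :=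
    Fin.snoc_last ..
  unfold hmmJoint
  rw [Fin.prod_univ_castSucc]
  simp only [h, h0, hs, hl]
  rw [← mul_assoc]
  rfl

lemma forward_castSucc {n : ℕ} {X Y : Fin (n+2) → Type*} [∀ i, Fintype (X i)]
    [∀ i, Fintype (Y i)]
    (f₀ : PMF (X 0)) (f : ∀ t : Fin (n+1), X t.castSucc → PMF (X t.succ))
    (g : ∀ t : Fin (n+2), X t → PMF (Y t)) (y : ∀ t, Y t) (t : Fin (n+1)) (x : X t.castSucc) :
    forward f₀ f g y t.castSucc x =
      forward (X := fun t => X t.castSucc) (Y := fun t => Y t.castSucc)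
        f₀ (fun t => f t.castSucc) (fun t => g t.castSucc) (fun t => y t.castSucc) t x := by
  unfold forward
  rw [prob_setOf, prob_setOf, sum_pi_snoc]
  refine Finset.sum_congr rfl fun ω _ => ?_
  have ht : ¬ n + 1 ≤ (t : ℕ) := by omega
  simp only [Fin.forall_fin_succ' (n := n+1), Fin.snoc_castSucc, Fin.val_castSucc, Fin.val_last,
    ht, false_imp_iff, and_true, hmmJoint_snoc]
  split_ifs
  · rw [← Finset.mul_sum, Fintype.sum_prod_type]
    simp [← Finset.mul_sum, sum_pmf]
  · simp

lemma forward_last {n : ℕ} {X Y : Fin (n+2) → Type*} [∀ i, Fintype (X i)]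
    [∀ i, Fintype (Y i)]
    (f₀ : PMF (X 0)) (f : ∀ t : Fin (n+1), X t.castSucc → PMF (X t.succ))
    (g : ∀ t : Fin (n+2), X t → PMF (Y t)) (y : ∀ t, Y t) (x : X (Fin.last (n+1))) :
    forward f₀ f g y (Fin.last (n+1)) x =
      g (Fin.last (n+1)) x (y (Fin.last (n+1))) * ∑ x', f (Fin.last n) x' x *
        forward (X := fun t => X t.castSucc) (Y := fun t => Y t.castSucc)
          f₀ (fun t => f t.castSucc) (fun t => g t.castSucc) (fun t => y t.castSucc)
          (Fin.last n) x' := by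
  unfold forward
  simp only [prob_setOf, Finset.mul_sum]
  rw [Finset.sum_comm, sum_pi_snoc]
  refine Finset.sum_congr rfl fun ω _ => ?_
  have hlt (i : Fin (n+1)) : (i : ℕ) ≤ n + 1 := by omega
  have hlt' (i : Fin (n+1)) : (i : ℕ) ≤ n := by omega
  simp only [Fin.forall_fin_succ' (n := n+1), Fin.snoc_castSucc, Fin.snoc_last, Fin.val_castSucc,
    Fin.val_last, hlt, hlt', le_refl, true_imp_iff, hmmJoint_snoc]
  by_cases h : ∀ i : Fin (n+1), (ω i).2 = y i.castSucc
  · simp only [h, implies_true, true_and, and_true]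
    rw [Fintype.sum_prod_type, Finset.sum_eq_single x, Finset.sum_eq_single (y (Fin.last (n+1))),
      Finset.sum_eq_single (ω (Fin.last n)).1]
    · simp only [and_self, if_true]
      ring
    · intro b _ hb
      simp [hb.symm]
    · simp
    · intro b _ hb
      simp [hb]
    · simp
    · intro b _ hb
      simp [hb]
    · simp
  · simp [h]

lemma forward_zero {n : ℕ} {X Y : Fin (n+1) → Type*} [∀ i, Fintype (X i)]
    [∀ i, Fintype (Y i)]
    (f₀ : PMF (X 0)) (f : ∀ t : Fin n, X t.castSucc → PMF (X t.succ))
    (g : ∀ t : Fin (n+1), X t → PMF (Y t)) (y : ∀ t, Y t) (x : X 0) :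
    forward f₀ f g y 0 x = g 0 x (y 0) * f₀ x := by
  induction n with
  | zero =>
    unfold forward
    rw [prob_setOf, Finset.sum_eq_single (fun t => Fin.cases (x, y 0) (fun i => i.elim0) t)]
    · simp [hmmJoint, mul_comm]
    · intro ω _ hω
      rw [if_neg]
      rintro ⟨h1, h2⟩
      apply hω
      funext t
      have := h2 0 le_rfl
      obtain rfl : t = 0 := Fin.fin_one_eq_zero t
      exact Prod.ext h1 this
    · simp
  | succ n ih =>
    exact (forward_castSucc f₀ f g y 0 x).trans (ih ..)

lemma forward_succ {n : ℕ} {X Y : Fin (n+1) → Type*} [∀ i, Fintype (X i)]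
    [∀ i, Fintype (Y i)]
    (f₀ : PMF (X 0)) (f : ∀ t : Fin n, X t.castSucc → PMF (X t.succ))
    (g : ∀ t : Fin (n+1), X t → PMF (Y t)) (y : ∀ t, Y t) (i : Fin n) (x : X i.succ) :
    forward f₀ f g y i.succ x =
      g i.succ x (y i.succ) * ∑ x', f i x' x * forward f₀ f g y i.castSucc x' := by
  induction n with
  | zero => exact i.elim0
  | succ n ih =>
    simp only [forward_castSucc]
    induction i using Fin.lastCases with
    | last => exact forward_last f₀ f g y x
    | cast i =>
      refine (forward_castSucc f₀ f g y i.succ x).trans ((ih ..).trans ?_)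
      rfl

lemma sum_forward {n : ℕ} {X Y : Fin (n+1) → Type*} [∀ i, Fintype (X i)]
    [∀ i, Fintype (Y i)]
    (f₀ : PMF (X 0)) (f : ∀ t : Fin n, X t.castSucc → PMF (X t.succ))
    (g : ∀ t : Fin (n+1), X t → PMF (Y t)) (y : ∀ t, Y t) (t : Fin (n+1)) :
    ∑ x, forward f₀ f g y t x = evidence f₀ f g y t := by
  simp only [forward, evidence, prob_setOf]
  rw [Finset.sum_comm]
  refine Finset.sum_congr rfl fun ω _ => ?_
  simp [ite_and]

lemma evidence_ne_top {n : ℕ} {X Y : Fin (n+1) → Type*} [∀ i, Fintype (X i)]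
    [∀ i, Fintype (Y i)]
    (f₀ : PMF (X 0)) (f : ∀ t : Fin n, X t.castSucc → PMF (X t.succ))
    (g : ∀ t : Fin (n+1), X t → PMF (Y t)) (y : ∀ t, Y t) (t : Fin (n+1)) :
    evidence f₀ f g y t ≠ ⊤ := by
  rw [evidence, prob_setOf, ENNReal.sum_ne_top]
  intro ω _
  split_ifs
  · exact ENNReal.mul_ne_top (ENNReal.mul_ne_top (PMF.apply_ne_top _ _) (PMF.apply_ne_top _ _))
      (ENNReal.prod_ne_top fun _ _ =>
        ENNReal.mul_ne_top (PMF.apply_ne_top _ _) (PMF.apply_ne_top _ _))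
  · exact ENNReal.zero_ne_top

lemma evidence_anti {n : ℕ} {X Y : Fin (n+1) → Type*} [∀ i, Fintype (X i)]
    [∀ i, Fintype (Y i)]
    (f₀ : PMF (X 0)) (f : ∀ t : Fin n, X t.castSucc → PMF (X t.succ))
    (g : ∀ t : Fin (n+1), X t → PMF (Y t)) (y : ∀ t, Y t) :
    Antitone (evidence f₀ f g y) :=
  fun _ _ hst => prob_mono _ fun _ hω i hi => hω i (hi.trans hst)

lemma bayesFilter_succ {n : ℕ} {X Y : Fin (n+1) → Type*} [∀ i, Fintype (X i)]
    (f₀ : PMF (X 0)) (f : ∀ t : Fin n, X t.castSucc → PMF (X t.succ))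
    (g : ∀ t : Fin (n+1), X t → PMF (Y t)) (y : ∀ t, Y t) (i : Fin n) (x : X i.succ) :
    bayesFilter f₀ f g y i.succ x =
      g i.succ x (y i.succ) * (∑ x', f i x' x * bayesFilter f₀ f g y i.castSucc x') /
        ∑ x'', g i.succ x'' (y i.succ) *
          ∑ x', f i x' x'' * bayesFilter f₀ f g y i.castSucc x' :=
  rfl

lemma update_eq_forward_div {n : ℕ} {X Y : Fin (n+1) → Type*} [∀ i, Fintype (X i)]
    [∀ i, Fintype (Y i)]
    (f₀ : PMF (X 0)) (f : ∀ t : Fin n, X t.castSucc → PMF (X t.succ))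
    (g : ∀ t : Fin (n+1), X t → PMF (Y t)) (y : ∀ t, Y t) (i : Fin n)
    (h : ∀ x, bayesFilter f₀ f g y i.castSucc x =
      forward f₀ f g y i.castSucc x / evidence f₀ f g y i.castSucc) (x : X i.succ) :
    g i.succ x (y i.succ) * (∑ x', f i x' x * bayesFilter f₀ f g y i.castSucc x') =
      forward f₀ f g y i.succ x / evidence f₀ f g y i.castSucc := by
  simp only [h, forward_succ, div_eq_mul_inv, ← mul_assoc, ← Finset.sum_mul]

lemma sum_div_evidence {n : ℕ} {X Y : Fin (n+1) → Type*} [∀ i, Fintype (X i)]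
    [∀ i, Fintype (Y i)]
    (f₀ : PMF (X 0)) (f : ∀ t : Fin n, X t.castSucc → PMF (X t.succ))
    (g : ∀ t : Fin (n+1), X t → PMF (Y t)) (y : ∀ t, Y t) (t : Fin (n+1)) (c : ℝ≥0∞) :
    ∑ x, forward f₀ f g y t x / c = evidence f₀ f g y t / c := by
  simp only [div_eq_mul_inv, ← Finset.sum_mul, sum_forward]

lemma bayesFilter_eq_forward_div_evidence {n : ℕ} {X Y : Fin (n+1) → Type*}
    [∀ i, Fintype (X i)] [∀ i, Fintype (Y i)]
    (f₀ : PMF (X 0)) (f : ∀ t : Fin n, X t.castSucc → PMF (X t.succ))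
    (g : ∀ t : Fin (n+1), X t → PMF (Y t)) (y : ∀ t, Y t) (t : Fin (n+1))
    (ht : evidence f₀ f g y t ≠ 0) (x : X t) :
    bayesFilter f₀ f g y t x = forward f₀ f g y t x / evidence f₀ f g y t := by
  induction t using Fin.induction with
  | zero =>
    rw [← sum_forward]
    simp only [forward_zero]
    rfl
  | succ i ih =>
    have hi : evidence f₀ f g y i.castSucc ≠ 0 :=
      ((pos_iff_ne_zero.2 ht).trans_le
        (evidence_anti f₀ f g y (Fin.castSucc_lt_succ (i := i)).le)).ne'
    rw [bayesFilter_succ]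
    simp only [update_eq_forward_div f₀ f g y i (ih hi), sum_div_evidence]
    rw [div_eq_mul_inv (forward ..), div_eq_mul_inv (evidence ..)]
    exact ENNReal.mul_div_mul_right _ _ (ENNReal.inv_ne_zero.2 (evidence_ne_top _ _ _ _ _))
      (ENNReal.inv_ne_top.2 hi)

lemma bayesPredict_denominator_pos {n : ℕ} {X Y : Fin (n+1) → Type*}
    [∀ i, Fintype (X i)] [∀ i, Fintype (Y i)]
    (f₀ : PMF (X 0)) (f : ∀ t : Fin n, X t.castSucc → PMF (X t.succ))
    (g : ∀ t : Fin (n+1), X t → PMF (Y t)) (y : ∀ t, Y t) (t : Fin (n+1))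
    (ht : evidence f₀ f g y t ≠ 0) :
    0 < ∑ x, g t x (y t) * bayesPredict f₀ f g y t x := by
  induction t using Fin.cases with
  | zero =>
    rw [← sum_forward] at ht
    simp only [forward_zero] at ht
    exact pos_iff_ne_zero.2 ht
  | succ i =>
    have hi : evidence f₀ f g y i.castSucc ≠ 0 :=
      ((pos_iff_ne_zero.2 ht).trans_le
        (evidence_anti f₀ f g y (Fin.castSucc_lt_succ (i := i)).le)).ne'
    have h := update_eq_forward_div f₀ f g y i
      (bayesFilter_eq_forward_div_evidence f₀ f g y i.castSucc hi)
    simp only [bayesPredict, Fin.cases_succ, h, sum_div_evidence]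
    exact ENNReal.div_pos ht (evidence_ne_top _ _ _ _ _)

/-- **Correctness of the instantiated Bayes filter in `FinStoch`**: if the observed
sequence `y_0, …, y_t` has positive probability, then all denominators in the recursion
are positive and `B_t(x)` equals the conditional probability of the hidden state `X_t = x`
given the observations `Y_0 = y_0, …, Y_t = y_t`. -/
theorem bayesFilter_eq_condProb
    (f₀ : PMF (X 0)) (f : ∀ t : Fin n, X t.castSucc → PMF (X t.succ))
    (g : ∀ t : Fin (n+1), X t → PMF (Y t)) (y : ∀ t, Y t)
    (t : ℕ) (ht : t ≤ n)
    (hpos : 0 < prob (hmmJoint f₀ f g)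
      {ω | ∀ i : Fin (n+1), (i : ℕ) ≤ t → (ω i).2 = y i}) :
    (∀ (i : ℕ) (hi : i ≤ t),
      0 < ∑ x, g ⟨i, by omega⟩ x (y ⟨i, by omega⟩) * bayesPredict f₀ f g y ⟨i, by omega⟩ x) ∧
    (∀ x : X ⟨t, by omega⟩,
      bayesFilter f₀ f g y ⟨t, by omega⟩ x =
        prob (hmmJoint f₀ f g)
            {ω | (ω ⟨t, by omega⟩).1 = x ∧ ∀ i : Fin (n+1), (i : ℕ) ≤ t → (ω i).2 = y i} /
          prob (hmmJoint f₀ f g) {ω | ∀ i : Fin (n+1), (i : ℕ) ≤ t → (ω i).2 = y i}) := by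
  have h : evidence f₀ f g y ⟨t, by omega⟩ ≠ 0 := hpos.ne'
  refine ⟨fun i hi => bayesPredict_denominator_pos f₀ f g y ⟨i, by omega⟩ ?_,
    bayesFilter_eq_forward_div_evidence f₀ f g y ⟨t, by omega⟩ h⟩
  have hit : (⟨i, by omega⟩ : Fin (n+1)) ≤ ⟨t, by omega⟩ := hi
  exact (hpos.trans_le (evidence_anti f₀ f g y hit)).ne'

end DiscreteHMM
end

section
/- With the update maps u_t and predicted observation distributions o_t as defined, and the posterior process M_t := u_t(M_{t-1}, Y_t) on the probability space (∏_{t=0}^n (X_t × Y_t), p), define the transition probabilities h_t(m' | m) := Σ_{y ∈ Y_t with u_t(m, y) = m'} o_t(m)(y). Then the posterior process is a Markov chain with these transitions: for all probability mass functions m_0 on X_0, …, m_n on X_n, P_p(M_0 = m_0 ∧ M_1 = m_1 ∧ ⋯ ∧ M_n = m_n) = h_0(m_0 | m_{-1}) · ∏_{t=1}^n h_t(m_t | m_{t-1}), where m_{-1} is the unique distribution on the one-point space X_{-1}. -/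
open scoped ENNReal Classical

namespace DiscreteHMM

variable {n : ℕ}

variable {X Y : Fin (n+1) → Type*} [∀ i, Fintype (X i)] [∀ i, Fintype (Y i)]
  [∀ i, Nonempty (X i)] [∀ i, Nonempty (Y i)]

/-- Predicted observation distribution at time `0`: `o_0(y) = Σ_{x'} g_0(y|x') f₀(x')`. -/
noncomputable def obs0 (f₀ : PMF (X 0)) (g : ∀ t : Fin (n+1), X t → PMF (Y t))
    (y₀ : Y 0) : ℝ≥0∞ :=
  ∑ x', g 0 x' y₀ * f₀ x'

/-- Bayesian update at time `0`, with default `d` when the observation has predicted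
probability zero. -/
noncomputable def upd0 (f₀ : PMF (X 0)) (g : ∀ t : Fin (n+1), X t → PMF (Y t))
    (d : X 0 → ℝ≥0∞) (y₀ : Y 0) : X 0 → ℝ≥0∞ :=
  if obs0 f₀ g y₀ = 0 then d else fun x => g 0 x y₀ * f₀ x / obs0 f₀ g y₀

/-- Predicted observation distribution
`o_t(m)(y) = Σ_x Σ_{x'} g_t(y|x') · f_t(x'|x) · m(x)`. -/
noncomputable def obsStep (f : ∀ t : Fin n, X t.castSucc → PMF (X t.succ))
    (g : ∀ t : Fin (n+1), X t → PMF (Y t)) (i : Fin n)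
    (m : X i.castSucc → ℝ≥0∞) (y : Y i.succ) : ℝ≥0∞ :=
  ∑ x, ∑ x', g i.succ x' y * f i x x' * m x

/-- Bayesian update `u_t(m, y)`: the posterior
`x' ↦ g_t(y|x') · (Σ_x f_t(x'|x) m(x)) / o_t(m)(y)` when `o_t(m)(y) > 0`, and the default
distribution `d` otherwise. -/
noncomputable def updStep (f : ∀ t : Fin n, X t.castSucc → PMF (X t.succ))
    (g : ∀ t : Fin (n+1), X t → PMF (Y t)) (i : Fin n) (d : X i.succ → ℝ≥0∞)
    (m : X i.castSucc → ℝ≥0∞) (y : Y i.succ) : X i.succ → ℝ≥0∞ :=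
  if obsStep f g i m y = 0 then d
  else fun x' => g i.succ x' y * (∑ x, f i x x' * m x) / obsStep f g i m y

/-- The random posterior process `M_t = u_t(M_{t-1}, Y_t)` of the Bayes filter, as a
function of the sample point `ω`. -/
noncomputable def post (f₀ : PMF (X 0)) (f : ∀ t : Fin n, X t.castSucc → PMF (X t.succ))
    (g : ∀ t : Fin (n+1), X t → PMF (Y t)) (d : ∀ t, X t → ℝ≥0∞) :
    ∀ t : Fin (n+1), (∀ i, X i × Y i) → X t → ℝ≥0∞ :=
  Fin.induction (fun ω => upd0 f₀ g (d 0) ((ω 0).2))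
    (fun i ih ω => updStep f g i (d i.succ) (ih ω) ((ω i.succ).2))

/-- The transition probability `h_0(m₀ | m_{-1}) = Σ_{y : u_0(y) = m₀} o_0(y)` of the
posterior process at time `0`. -/
noncomputable def trans0 (f₀ : PMF (X 0)) (g : ∀ t : Fin (n+1), X t → PMF (Y t))
    (d : ∀ t, X t → ℝ≥0∞) (m₀ : X 0 → ℝ≥0∞) : ℝ≥0∞ :=
  ∑ y₀ : Y 0, if upd0 f₀ g (d 0) y₀ = m₀ then obs0 f₀ g y₀ else 0

/-- The transition probability `h_t(m' | m) = Σ_{y : u_t(m,y) = m'} o_t(m)(y)` of the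
posterior process. -/
noncomputable def transStep (f : ∀ t : Fin n, X t.castSucc → PMF (X t.succ))
    (g : ∀ t : Fin (n+1), X t → PMF (Y t)) (d : ∀ t, X t → ℝ≥0∞) (i : Fin n)
    (m : X i.castSucc → ℝ≥0∞) (m' : X i.succ → ℝ≥0∞) : ℝ≥0∞ :=
  ∑ y : Y i.succ, if updStep f g i (d i.succ) m y = m' then obsStep f g i m y else 0

/-- Averaging a test function against unnormalised posteriors `w y`, over the observations `y`
whose normalised posterior is `m`, amounts to averaging it against `m`. -/
theorem sum_normalize_eq {A B : Type*} [Fintype A] [Fintype B] {w : B → A → ℝ≥0∞}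
    {o : B → ℝ≥0∞} (ho : ∀ y, o y = ∑ x, w y x) (ho' : ∀ y, o y ≠ ⊤) {d : A → ℝ≥0∞}
    {u : B → A → ℝ≥0∞} (hu : ∀ y, u y = if o y = 0 then d else fun x => w y x / o y)
    (m F : A → ℝ≥0∞) :
    ∑ y, ∑ x, (if u y = m then w y x * F x else 0) =
      (∑ y, if u y = m then o y else 0) * ∑ x, m x * F x := by
  rw [Finset.sum_mul]
  refine Finset.sum_congr rfl fun y _ => ?_
  by_cases h : u y = m
  · simp only [h, if_true, Finset.mul_sum]
    refine Finset.sum_congr rfl fun x _ => ?_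
    rw [← mul_assoc]
    congr 1
    by_cases h0 : o y = 0
    · have := ho y
      rw [h0, eq_comm, Finset.sum_eq_zero_iff] at this
      rw [h0, zero_mul, this x (Finset.mem_univ x)]
    · rw [← h, hu, if_neg h0, ENNReal.mul_div_cancel h0 (ho' y)]
  · simp [h]

/-- A function reached by normalisation with nonzero weight has total mass one. -/
theorem sum_eq_one_of_normalize {A B : Type*} [Fintype A] [Fintype B] {w : B → A → ℝ≥0∞}
    {o : B → ℝ≥0∞} (ho : ∀ y, o y = ∑ x, w y x) (ho' : ∀ y, o y ≠ ⊤) {d : A → ℝ≥0∞}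
    {u : B → A → ℝ≥0∞} (hu : ∀ y, u y = if o y = 0 then d else fun x => w y x / o y)
    {m : A → ℝ≥0∞} (h : (∑ y, if u y = m then o y else 0) ≠ 0) : ∑ x, m x = 1 := by
  obtain ⟨y, -, hy⟩ := Finset.exists_ne_zero_of_sum_ne_zero h
  obtain ⟨rfl, h0⟩ : u y = m ∧ o y ≠ 0 := by simpa using hy
  simp only [hu, if_neg h0, div_eq_mul_inv]
  rw [← Finset.sum_mul, ← ho, ENNReal.mul_inv_cancel h0 (ho' y)]

section

variable {N : ℕ} {S T : Fin (N+1) → Type*} [∀ i, Fintype (S i)]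

theorem obs0_ne_top (f₀ : PMF (S 0)) (g : ∀ t : Fin (N+1), S t → PMF (T t)) (y : T 0) :
    obs0 f₀ g y ≠ ⊤ :=
  ENNReal.sum_ne_top.2 fun x _ => ENNReal.mul_ne_top ((g 0 x).apply_ne_top y) (f₀.apply_ne_top x)

theorem obsStep_eq_sum (f : ∀ t : Fin N, S t.castSucc → PMF (S t.succ))
    (g : ∀ t : Fin (N+1), S t → PMF (T t)) (i : Fin N) (m : S i.castSucc → ℝ≥0∞)
    (y : T i.succ) :
    obsStep f g i m y = ∑ x', g i.succ x' y * ∑ x, f i x x' * m x := by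
  simp only [obsStep, Finset.mul_sum, mul_assoc]
  exact Finset.sum_comm

theorem obsStep_ne_top (f : ∀ t : Fin N, S t.castSucc → PMF (S t.succ))
    (g : ∀ t : Fin (N+1), S t → PMF (T t)) (i : Fin N) {m : S i.castSucc → ℝ≥0∞}
    (hm : ∑ x, m x = 1) (y : T i.succ) : obsStep f g i m y ≠ ⊤ := by
  have hm' : ∀ x, m x ≠ ⊤ := fun x =>
    ENNReal.sum_ne_top.1 (hm ▸ ENNReal.one_ne_top) x (Finset.mem_univ x)
  refine ENNReal.sum_ne_top.2 fun x _ => ENNReal.sum_ne_top.2 fun x' _ => ?_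
  exact ENNReal.mul_ne_top
    (ENNReal.mul_ne_top ((g i.succ x').apply_ne_top y) ((f i x).apply_ne_top x')) (hm' x)

variable [∀ i, Fintype (T i)]

theorem sum_eq_one_of_trans0_ne_zero (f₀ : PMF (S 0)) (g : ∀ t : Fin (N+1), S t → PMF (T t))
    (d : ∀ t, S t → ℝ≥0∞) {m : S 0 → ℝ≥0∞} (h : trans0 f₀ g d m ≠ 0) : ∑ x, m x = 1 :=
  sum_eq_one_of_normalize (fun _ => rfl) (obs0_ne_top f₀ g) (fun _ => rfl) h

theorem sum_eq_one_of_transStep_ne_zero (f : ∀ t : Fin N, S t.castSucc → PMF (S t.succ))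
    (g : ∀ t : Fin (N+1), S t → PMF (T t)) (d : ∀ t, S t → ℝ≥0∞) (i : Fin N)
    {m : S i.castSucc → ℝ≥0∞} (hm : ∑ x, m x = 1) {m' : S i.succ → ℝ≥0∞}
    (h : transStep f g d i m m' ≠ 0) : ∑ x, m' x = 1 :=
  sum_eq_one_of_normalize (obsStep_eq_sum f g i m) (obsStep_ne_top f g i hm) (fun _ => rfl) h

theorem sum_eq_one_of_prod_ne_zero (f₀ : PMF (S 0))
    (f : ∀ t : Fin N, S t.castSucc → PMF (S t.succ)) (g : ∀ t : Fin (N+1), S t → PMF (T t))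
    (d m : ∀ t, S t → ℝ≥0∞)
    (h : trans0 f₀ g d (m 0) * ∏ i, transStep f g d i (m i.castSucc) (m i.succ) ≠ 0)
    (t : Fin (N+1)) : ∑ x, m t x = 1 := by
  rw [mul_ne_zero_iff, Finset.prod_ne_zero_iff] at h
  induction t using Fin.induction with
  | zero => exact sum_eq_one_of_trans0_ne_zero f₀ g d h.1
  | succ i ih => exact sum_eq_one_of_transStep_ne_zero f g d i ih (h.2 i (Finset.mem_univ i))

end

theorem post_succ {N : ℕ} {S T : Fin (N+1) → Type*} [∀ i, Fintype (S i)]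
    (f₀ : PMF (S 0)) (f : ∀ t : Fin N, S t.castSucc → PMF (S t.succ))
    (g : ∀ t : Fin (N+1), S t → PMF (T t)) (d : ∀ t, S t → ℝ≥0∞) (i : Fin N)
    (ω : ∀ i, S i × T i) :
    post f₀ f g d i.succ ω =
      updStep f g i (d i.succ) (post f₀ f g d i.castSucc ω) (ω i.succ).2 :=
  rfl

/-- The posteriors of a model up to the penultimate time are those of the truncated model. -/
theorem post_castSucc {N : ℕ} {S T : Fin (N+2) → Type*} [∀ i, Fintype (S i)]
    (f₀ : PMF (S 0)) (f : ∀ t : Fin (N+1), S t.castSucc → PMF (S t.succ))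
    (g : ∀ t : Fin (N+2), S t → PMF (T t)) (d : ∀ t, S t → ℝ≥0∞)
    (ω : ∀ i : Fin (N+1), S i.castSucc × T i.castSucc)
    (z : S (Fin.last (N+1)) × T (Fin.last (N+1))) (t : Fin (N+1)) :
    post f₀ f g d t.castSucc (Fin.snoc (α := fun i => S i × T i) ω z) =
      post (X := fun i => S i.castSucc) (Y := fun i => T i.castSucc) f₀
        (fun i => f i.castSucc) (fun i => g i.castSucc) (fun i => d i.castSucc) t ω := by
  have hω : ∀ j : Fin (N+1),
      Fin.snoc (α := fun i => S i × T i) ω z j.castSucc = ω j := fun j => Fin.snoc_castSucc ..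
  induction t using Fin.induction with
  | zero => exact congrArg (fun p => upd0 f₀ g (d 0) p.2) (hω 0)
  | succ i ih =>
    refine (post_succ f₀ f g d i.castSucc _).trans (Eq.trans ?_ (post_succ
      (S := fun i => S i.castSucc) (T := fun i => T i.castSucc) f₀
      (fun i => f i.castSucc) (fun i => g i.castSucc)
      (fun i => d i.castSucc) i ω).symm)
    exact congrArg₂ (fun (a : S i.castSucc.castSucc → ℝ≥0∞)
      (p : S i.castSucc.succ × T i.castSucc.succ) =>
        updStep f g i.castSucc (d i.castSucc.succ) a p.2) ih (hω i.succ)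

/-- On the event that the posteriors are `m`, the joint law averages a function of the final
hidden state as the final posterior does. -/
theorem sum_hmmJoint_mul_eq {N : ℕ} {S T : Fin (N+1) → Type*} [∀ i, Fintype (S i)]
    [∀ i, Fintype (T i)]
    (f₀ : PMF (S 0)) (f : ∀ t : Fin N, S t.castSucc → PMF (S t.succ))
    (g : ∀ t : Fin (N+1), S t → PMF (T t)) (d m : ∀ t, S t → ℝ≥0∞)
    (F : S (Fin.last N) → ℝ≥0∞) :
    ∑ ω, (if ∀ t, post f₀ f g d t ω = m t then hmmJoint f₀ f g ω else 0) *
        F (ω (Fin.last N)).1 =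
      trans0 f₀ g d (m 0) * (∏ i : Fin N, transStep f g d i (m i.castSucc) (m i.succ)) *
        ∑ x, m (Fin.last N) x * F x := by
  induction N with
  | zero =>
    have key := sum_normalize_eq (fun _ => rfl) (obs0_ne_top f₀ g)
      (u := upd0 f₀ g (d 0)) (fun _ => rfl) (m 0) F
    rw [Fin.prod_univ_zero, mul_one]
    refine Eq.trans ?_ key
    rw [Finset.sum_comm, ← Fintype.sum_prod_type']
    refine Fintype.sum_equiv (Equiv.piUnique (α := Fin 1) fun i => S i × T i) _ _ fun ω => ?_
    have h : (∀ t, post f₀ f g d t ω = m t) ↔ upd0 f₀ g (d 0) (ω 0).2 = m 0 :=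
      ⟨fun h => h 0, fun h t => t.cases h fun i => i.elim0⟩
    simp only [h, hmmJoint, Fin.prod_univ_zero, mul_one, ite_mul, zero_mul,
      mul_comm (f₀ _)]
    rfl
  | succ N ih =>
    set P := trans0 f₀ g d (m 0) *
      ∏ i : Fin N, transStep f g d i.castSucc (m i.castSucc.castSucc) (m i.castSucc.succ) with hP
    let l := Fin.last N
    let G : S l.castSucc → ℝ≥0∞ := fun a => ∑ z : S l.succ × T l.succ,
      if updStep f g l (d l.succ) (m l.castSucc) z.2 = m l.succ then
        f l a z.1 * g l.succ z.1 z.2 * F z.1 else 0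
    have ih' := ih (S := fun i => S i.castSucc) (T := fun i => T i.castSucc) f₀
      (fun i => f i.castSucc) (fun i => g i.castSucc) (fun i => d i.castSucc)
      (fun i => m i.castSucc) G
    have hsum : ∑ ω, (if ∀ t, post f₀ f g d t ω = m t then hmmJoint f₀ f g ω else 0) *
        F (ω (Fin.last (N+1))).1 = P * ∑ a, m l.castSucc a * G a := by
      refine Eq.trans ?_ ih'
      rw [← (Fin.snocEquiv fun i => S i × T i).sum_comp, Fintype.sum_prod_type_right]
      refine Finset.sum_congr rfl fun ω _ => ?_
      simp only [G, Finset.mul_sum]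
      refine Finset.sum_congr rfl fun z _ => ?_
      let ω' : ∀ i, S i × T i := Fin.snoc (α := fun i => S i × T i) ω z
      have hω : ∀ j : Fin (N+1), ω' j.castSucc = ω j := fun j => Fin.snoc_castSucc ..
      have hz : ω' (Fin.last (N+1)) = z := Fin.snoc_last ..
      have hpost := post_castSucc f₀ f g d ω z
      have hevent : (∀ t, post f₀ f g d t ω' = m t) ↔
          (∀ t, post (X := fun i => S i.castSucc) (Y := fun i => T i.castSucc) f₀
            (fun i => f i.castSucc) (fun i => g i.castSucc) (fun i => d i.castSucc) t ω =
              m t.castSucc) ∧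
          updStep f g l (d l.succ) (m l.castSucc) z.2 = m l.succ := by
        rw [Fin.forall_fin_succ']
        simp only [ω', hpost]
        refine and_congr_right fun h => ?_
        have : post f₀ f g d l.succ ω' = updStep f g l (d l.succ) (m l.castSucc) z.2 :=
          (post_succ f₀ f g d l ω').trans (congrArg₂ (fun (a : S l.castSucc → ℝ≥0∞)
            (p : S l.succ × T l.succ) => updStep f g l (d l.succ) a p.2)
            ((hpost l).trans (h l)) hz)
        exact Eq.congr_left this
      have hjoint : hmmJoint f₀ f g ω' =
          hmmJoint (X := fun i => S i.castSucc) (Y := fun i => T i.castSucc) f₀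
            (fun i => f i.castSucc) (fun i => g i.castSucc) ω *
          (f l (ω l).1 z.1 * g l.succ z.1 z.2) := by
        have hstep : ∀ (i : Fin (N+1)) (a : S i.castSucc × T i.castSucc)
            (b : S i.succ × T i.succ), ω' i.castSucc = a → ω' i.succ = b →
            f i (ω' i.castSucc).1 (ω' i.succ).1 * g i.succ (ω' i.succ).1 (ω' i.succ).2 =
              f i a.1 b.1 * g i.succ b.1 b.2 := by
          rintro i _ _ rfl rfl
          rfl
        unfold hmmJoint
        rw [Fin.prod_univ_castSucc, ← mul_assoc]
        refine congrArg₂ (· * ·) (congrArg₂ (· * ·) ?_ ?_) (hstep l _ _ (hω l) hz)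
        · exact congrArg (fun p => f₀ p.1 * g 0 p.1 p.2) (hω 0)
        · exact Finset.prod_congr rfl fun i _ =>
            hstep i.castSucc _ _ (hω i.castSucc) (hω i.succ)
      change (if ∀ t, post f₀ f g d t ω' = m t then hmmJoint f₀ f g ω' else 0) *
        F (ω' (Fin.last (N+1))).1 = _
      rw [hz, hjoint, if_congr hevent rfl rfl, ite_and]
      split_ifs <;> simp [mul_assoc]
      rfl
    rw [hsum, Fin.prod_univ_castSucc, ← mul_assoc]
    change _ = P * _ * _
    rcases eq_or_ne P 0 with h0 | h0
    · simp [h0]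
    have hm : ∑ x, m l.castSucc x = 1 :=
      sum_eq_one_of_prod_ne_zero (S := fun i => S i.castSucc) (T := fun i => T i.castSucc) f₀
        (fun i => f i.castSucc) (fun i => g i.castSucc) (fun i => d i.castSucc)
        (fun i => m i.castSucc) h0 l
    rw [mul_assoc P]
    refine congrArg (P * ·) (Eq.trans ?_ (sum_normalize_eq (obsStep_eq_sum f g l (m l.castSucc))
      (obsStep_ne_top f g l hm) (u := updStep f g l (d l.succ) (m l.castSucc))
      (fun _ => rfl) (m l.succ) F))
    simp only [G, Finset.mul_sum]
    rw [Finset.sum_comm, Fintype.sum_prod_type_right]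
    refine Finset.sum_congr rfl fun y _ => Finset.sum_congr rfl fun x _ => ?_
    split_ifs
    · rw [Finset.sum_mul]
      exact Finset.sum_congr rfl fun a _ => by ring
    · simp

/-- **The Bayes filter posterior process is a Markov chain** (`FinStoch` version of the
theorem that the filter process is a Markov chain with transition kernels `h_t`). -/
theorem post_markovChain
    (f₀ : PMF (X 0)) (f : ∀ t : Fin n, X t.castSucc → PMF (X t.succ))
    (g : ∀ t : Fin (n+1), X t → PMF (Y t)) (d : ∀ t, X t → ℝ≥0∞)
    (hd : ∀ t, ∑ x, d t x = 1) :
    ∀ m : ∀ t : Fin (n+1), X t → ℝ≥0∞,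
      prob (hmmJoint f₀ f g) {ω | ∀ t, post f₀ f g d t ω = m t} =
        trans0 f₀ g d (m 0) * ∏ i : Fin n, transStep f g d i (m i.castSucc) (m i.succ) := by
  intro m
  have h := sum_hmmJoint_mul_eq f₀ f g d m fun _ => 1
  simp only [mul_one] at h
  simp only [prob, Set.indicator_apply, Set.mem_ofPred_eq]
  rw [h]
  rcases eq_or_ne (trans0 f₀ g d (m 0) *
    ∏ i : Fin n, transStep f g d i (m i.castSucc) (m i.succ)) 0 with h0 | h0
  · rw [h0, zero_mul]
  · rw [sum_eq_one_of_prod_ne_zero f₀ f g d m h0, mul_one]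

end DiscreteHMM
end

section
/- Fix observations y_0 ∈ Y_0, …, y_n ∈ Y_n with p^Y_{[n]}(y_0, …, y_n) > 0. Let α_t(y_0, …, y_t, x) := P_p(Y_0 = y_0, …, Y_t = y_t, X_t = x), and let β_t be defined by the backward recursion β_n ≡ 1 and β_t(y_{t+1}, …, y_n | x) := Σ_{x' ∈ X_{t+1}} g_{t+1}(y_{t+1} | x') · β_{t+1}(y_{t+2}, …, y_n | x') · f_{t+1}(x' | x). Then the forward-backward algorithm is correct: for every 0 ≤ t ≤ n and x ∈ X_t, P_p(X_t = x | Y_0 = y_0, …, Y_n = y_n) = α_t(y_0, …, y_t, x) · β_t(y_{t+1}, …, y_n | x) / (Σ_{x' ∈ X_t} α_t(y_0, …, y_t, x') · β_t(y_{t+1}, …, y_n | x')), where the denominator equals p^Y_{[n]}(y_0, …, y_n) and is in particular positive. -/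
open scoped ENNReal Classical

namespace DiscreteHMM

variable {n : ℕ}

variable {X Y : Fin (n+1) → Type*} [∀ i, Fintype (X i)] [∀ i, Fintype (Y i)]
  [∀ i, Nonempty (X i)] [∀ i, Nonempty (Y i)]

/-- The backward quantities `β_t`, defined by the backward recursion `β_n(x) = 1` and
`β_t(y_{t+1},…,y_n | x) = Σ_{x'} g_{t+1}(y_{t+1}|x') · β_{t+1}(y_{t+2},…,y_n|x') ·
f_{t+1}(x'|x)`. -/
noncomputable def backward (f : ∀ t : Fin n, X t.castSucc → PMF (X t.succ))
    (g : ∀ t : Fin (n+1), X t → PMF (Y t)) (y : ∀ t, Y t) :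
    ∀ t : Fin (n+1), X t → ℝ≥0∞ :=
  Fin.reverseInduction (fun _ => 1)
    (fun i ih x => ∑ x' : X i.succ, g i.succ x' (y i.succ) * ih x' * f i x x')

theorem prob_and_const {Ω : Type*} [Fintype Ω] (p : Ω → ℝ≥0∞) (c : Prop) (P : Ω → Prop) :
    prob p {ω | c ∧ P ω} = if c then prob p {ω | P ω} else 0 := by
  by_cases hc : c <;> simp [hc, prob]

theorem prob_hmmJoint_zero {X Y : Fin 1 → Type*} [∀ i, Fintype (X i)] [∀ i, Fintype (Y i)]
    (f₀ : PMF (X 0)) (f : ∀ t : Fin 0, X t.castSucc → PMF (X t.succ))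
    (g : ∀ t : Fin 1, X t → PMF (Y t)) (E : Set (∀ t, X t × Y t)) :
    prob (hmmJoint f₀ f g) E = ∑ x : X 0, f₀ x * ∑ y : Y 0, g 0 x y *
      if (Fin.cons (x, y) fun i => i.elim0 : ∀ t, X t × Y t) ∈ E then 1 else 0 := by
  rw [prob, ← (Fin.consEquiv fun t => X t × Y t).sum_comp, Fintype.sum_prod_type,
    Fintype.sum_prod_type]
  refine Finset.sum_congr rfl fun x _ => ?_
  rw [Finset.mul_sum]
  refine Finset.sum_congr rfl fun y _ => ?_
  rw [Fintype.sum_unique, ← mul_assoc, mul_ite, mul_one, mul_zero, Set.indicator_apply]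
  simp only [Fin.consEquiv, Equiv.coe_fn_mk]
  rw [Subsingleton.elim (default : ∀ i : Fin 0, X i.succ × Y i.succ) fun i => i.elim0]
  simp [hmmJoint]

/-- Conditioning a hidden Markov model on its first hidden state and observation leaves the
hidden Markov model started one step later. -/
theorem prob_hmmJoint_succ {n : ℕ} {X Y : Fin (n + 2) → Type*} [∀ i, Fintype (X i)]
    [∀ i, Fintype (Y i)] (f₀ : PMF (X 0)) (f : ∀ t : Fin (n + 1), X t.castSucc → PMF (X t.succ))
    (g : ∀ t : Fin (n + 2), X t → PMF (Y t)) (E : Set (∀ t, X t × Y t)) :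
    prob (hmmJoint f₀ f g) E = ∑ x : X 0, f₀ x * ∑ y : Y 0, g 0 x y *
      prob (hmmJoint (X := fun t => X t.succ) (Y := fun t => Y t.succ)
        (f 0 x) (fun t => f t.succ) (fun t => g t.succ))
        {ω | (Fin.cons (x, y) ω : ∀ t, X t × Y t) ∈ E} := by
  rw [prob, ← (Fin.consEquiv fun t => X t × Y t).sum_comp, Fintype.sum_prod_type,
    Fintype.sum_prod_type]
  refine Finset.sum_congr rfl fun x _ => ?_
  rw [Finset.mul_sum]
  refine Finset.sum_congr rfl fun y _ => ?_
  rw [prob, ← mul_assoc, Finset.mul_sum]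
  refine Finset.sum_congr rfl fun ω _ => ?_
  simp only [Set.indicator_apply, Set.mem_ofPred_eq, mul_ite, mul_zero]
  refine if_congr Iff.rfl ?_ rfl
  rw [hmmJoint, Fin.prod_univ_succ, hmmJoint]
  rfl

theorem sum_pmf_eq_one {α : Type*} [Fintype α] (q : PMF α) : ∑ a, q a = 1 := by
  rw [← tsum_fintype (L := .unconditional _), q.tsum_coe]

theorem prob_hmmJoint_univ {n : ℕ} {X Y : Fin (n + 1) → Type*} [∀ i, Fintype (X i)]
    [∀ i, Fintype (Y i)] (f₀ : PMF (X 0)) (f : ∀ t : Fin n, X t.castSucc → PMF (X t.succ))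
    (g : ∀ t : Fin (n + 1), X t → PMF (Y t)) :
    prob (hmmJoint f₀ f g) Set.univ = 1 := by
  induction n with
  | zero => simp [prob_hmmJoint_zero, sum_pmf_eq_one]
  | succ n ih =>
    simp only [prob_hmmJoint_succ, Set.mem_univ, Set.ofPred_true, ih]
    simp [sum_pmf_eq_one]

theorem backward_last {n : ℕ} {X Y : Fin (n + 1) → Type*} [∀ i, Fintype (X i)]
    (f : ∀ t : Fin n, X t.castSucc → PMF (X t.succ))
    (g : ∀ t : Fin (n + 1), X t → PMF (Y t)) (y : ∀ t, Y t) (x : X (Fin.last n)) :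
    backward f g y (Fin.last n) x = 1 := by
  simp [backward]

theorem backward_castSucc {n : ℕ} {X Y : Fin (n + 1) → Type*} [∀ i, Fintype (X i)]
    (f : ∀ t : Fin n, X t.castSucc → PMF (X t.succ))
    (g : ∀ t : Fin (n + 1), X t → PMF (Y t)) (y : ∀ t, Y t) (t : Fin n) (x : X t.castSucc) :
    backward f g y t.castSucc x =
      ∑ x' : X t.succ, g t.succ x' (y t.succ) * backward f g y t.succ x' * f t x x' := by
  simp [backward]

theorem backward_succ {n : ℕ} {X Y : Fin (n + 2) → Type*} [∀ i, Fintype (X i)]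
    (f : ∀ t : Fin (n + 1), X t.castSucc → PMF (X t.succ))
    (g : ∀ t : Fin (n + 2), X t → PMF (Y t)) (y : ∀ t, Y t) (t : Fin (n + 1)) (x : X t.succ) :
    backward f g y t.succ x =
      backward (X := fun t => X t.succ) (Y := fun t => Y t.succ)
        (fun t => f t.succ) (fun t => g t.succ) (fun t => y t.succ) t x := by
  induction t using Fin.reverseInduction with
  | last => exact (backward_last f g y x).trans (backward_last (X := fun t => X t.succ)
    (Y := fun t => Y t.succ) (fun t => f t.succ) (fun t => g t.succ) (fun t => y t.succ) x).symm
  | cast t ih =>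
    rw [backward_castSucc]
    refine (backward_castSucc f g y t.succ x).trans (Finset.sum_congr rfl fun x' _ => ?_)
    rw [ih]

theorem prob_obs_eq_sum_backward {n : ℕ} {X Y : Fin (n + 1) → Type*} [∀ i, Fintype (X i)]
    [∀ i, Fintype (Y i)] (f₀ : PMF (X 0)) (f : ∀ t : Fin n, X t.castSucc → PMF (X t.succ))
    (g : ∀ t : Fin (n + 1), X t → PMF (Y t)) (y : ∀ t, Y t) :
    prob (hmmJoint f₀ f g) {ω | ∀ i, (ω i).2 = y i} =
      ∑ x, f₀ x * (g 0 x (y 0) * backward f g y 0 x) := by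
  induction n with
  | zero =>
    have h (x : X 0) : backward f g y 0 x = 1 := backward_last f g y x
    simp [prob_hmmJoint_zero, h]
  | succ n ih =>
    rw [prob_hmmJoint_succ]
    refine Finset.sum_congr rfl fun x _ => congrArg _ ?_
    have h : backward f g y 0 x = _ := backward_castSucc f g y 0 x
    simp only [Set.mem_ofPred_eq, Fin.forall_fin_succ (n := n + 1), Fin.cons_zero, Fin.cons_succ,
      prob_and_const, ih, mul_ite, mul_zero, Finset.sum_ite_eq', Finset.mem_univ, if_true, h,
      backward_succ]
    exact congrArg _ (Finset.sum_congr rfl fun x' _ => mul_comm _ _)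

/-- The joint probability of all observations and one hidden state factors into the forward and
backward quantities. -/
theorem prob_state_obs_eq_forward_mul_backward {n : ℕ} {X Y : Fin (n + 1) → Type*}
    [∀ i, Fintype (X i)] [∀ i, Fintype (Y i)] (f₀ : PMF (X 0))
    (f : ∀ t : Fin n, X t.castSucc → PMF (X t.succ))
    (g : ∀ t : Fin (n + 1), X t → PMF (Y t)) (y : ∀ t, Y t) (t : Fin (n + 1)) (x : X t) :
    prob (hmmJoint f₀ f g) {ω | (ω t).1 = x ∧ ∀ i, (ω i).2 = y i} =
      prob (hmmJoint f₀ f g) {ω | (∀ i, i ≤ t → (ω i).2 = y i) ∧ (ω t).1 = x} *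
        backward f g y t x := by
  induction n with
  | zero =>
    obtain rfl : t = 0 := Fin.fin_one_eq_zero t
    rw [show backward f g y 0 x = 1 from backward_last f g y x, mul_one]
    congr 1
    ext ω
    simp [and_comm]
  | succ n ih =>
    rw [prob_hmmJoint_succ, prob_hmmJoint_succ, Finset.sum_mul]
    refine Finset.sum_congr rfl fun x₀ _ => ?_
    rw [mul_assoc, Finset.sum_mul]
    refine congrArg _ (Finset.sum_congr rfl fun y₀ _ => ?_)
    rw [mul_assoc]
    congr 1
    cases t using Fin.cases with
    | zero =>
      have h : backward f g y 0 x = _ := backward_castSucc f g y 0 x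
      by_cases hx : x₀ = x
      · subst hx
        by_cases hy : y₀ = y 0
        · have hall : {ω : ∀ t : Fin (n + 1), X t.succ × Y t.succ |
              (Fin.cons (x₀, y₀) ω : ∀ t, X t × Y t) ∈
                {ω : ∀ t, X t × Y t | (ω 0).1 = x₀ ∧ ∀ i, (ω i).2 = y i}} =
              {ω | ∀ i, (ω i).2 = y i.succ} := by
            ext ω
            simp [Fin.forall_fin_succ (n := n + 1), hy]
          have hfirst : {ω : ∀ t : Fin (n + 1), X t.succ × Y t.succ |
              (Fin.cons (x₀, y₀) ω : ∀ t, X t × Y t) ∈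
                {ω : ∀ t, X t × Y t | (∀ i, i ≤ 0 → (ω i).2 = y i) ∧ (ω 0).1 = x₀}} =
              Set.univ := by
            ext ω
            simp [hy]
          rw [hall, hfirst, prob_hmmJoint_univ, one_mul, h]
          refine (prob_obs_eq_sum_backward (X := fun t => X t.succ) (Y := fun t => Y t.succ)
            (f 0 x₀) (fun t => f t.succ) (fun t => g t.succ) (fun t => y t.succ)).trans
            (Finset.sum_congr rfl fun x' _ => ?_)
          rw [backward_succ, mul_comm]
        · simp [Fin.forall_fin_succ (n := n + 1), hy, prob]
      · simp [hx, prob]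
    | succ t =>
      rw [backward_succ]
      by_cases hy : y₀ = y 0
      · simpa [Fin.forall_fin_succ (n := n + 1), hy] using
          ih (X := fun t => X t.succ) (Y := fun t => Y t.succ) (f 0 x₀) (fun t => f t.succ)
            (fun t => g t.succ) (fun t => y t.succ) t x
      · simp [Fin.forall_fin_succ (n := n + 1), hy, prob]

theorem sum_prob_fiber {Ω α : Type*} [Fintype Ω] [Fintype α] (p : Ω → ℝ≥0∞) (T : Ω → α)
    (P : Ω → Prop) : ∑ a, prob p {ω | T ω = a ∧ P ω} = prob p {ω | P ω} := by
  simp only [prob]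
  rw [Finset.sum_comm]
  refine Finset.sum_congr rfl fun ω _ => ?_
  simp [Set.indicator_apply, ite_and]

/-- **Correctness of the forward-backward algorithm in `FinStoch`**: given an
observation sequence of positive probability, for every `t` the normalizer
`Σ_{x'} α_t(x') · β_t(x')` equals `p^Y_{[n]}(y_0,…,y_n)` (in particular it is positive),
and the conditional distribution of the hidden state given all the observations is
`P(X_t = x | Y = y) = α_t(x) · β_t(x) / Σ_{x'} α_t(x') · β_t(x')`. -/
theorem forwardBackward_correct
    (f₀ : PMF (X 0)) (f : ∀ t : Fin n, X t.castSucc → PMF (X t.succ))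
    (g : ∀ t : Fin (n+1), X t → PMF (Y t)) (y : ∀ t, Y t)
    (hpos : 0 < prob (hmmJoint f₀ f g) {ω | ∀ i, (ω i).2 = y i}) :
    ∀ t : Fin (n+1),
      (∑ x' : X t,
          prob (hmmJoint f₀ f g) {ω | (∀ i, i ≤ t → (ω i).2 = y i) ∧ (ω t).1 = x'} *
            backward f g y t x')
        = prob (hmmJoint f₀ f g) {ω | ∀ i, (ω i).2 = y i} ∧
      ∀ x : X t,
        prob (hmmJoint f₀ f g) {ω | (ω t).1 = x ∧ ∀ i, (ω i).2 = y i} /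
            prob (hmmJoint f₀ f g) {ω | ∀ i, (ω i).2 = y i} =
          prob (hmmJoint f₀ f g) {ω | (∀ i, i ≤ t → (ω i).2 = y i) ∧ (ω t).1 = x} *
              backward f g y t x /
            ∑ x' : X t,
              prob (hmmJoint f₀ f g) {ω | (∀ i, i ≤ t → (ω i).2 = y i) ∧ (ω t).1 = x'} *
                backward f g y t x' := by
  intro t
  have hsum : (∑ x' : X t,
      prob (hmmJoint f₀ f g) {ω | (∀ i, i ≤ t → (ω i).2 = y i) ∧ (ω t).1 = x'} *
        backward f g y t x') = prob (hmmJoint f₀ f g) {ω | ∀ i, (ω i).2 = y i} := by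
    simp only [← prob_state_obs_eq_forward_mul_backward]
    exact sum_prob_fiber (hmmJoint f₀ f g) (fun ω => (ω t).1) fun ω => ∀ i, (ω i).2 = y i
  exact ⟨hsum, fun x => by rw [hsum, prob_state_obs_eq_forward_mul_backward]⟩

end DiscreteHMM
end
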